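/- arXiv:1908.03644 — 4 statements merged into one kernel-verified Lean document; each statement's English description precedes it below -/
import Mathlib

section
/- Let ρ, r > 0 and let f(z,w) be holomorphic on the polydisk {|z| < r} × {|w| < ρ} ⊆ ℂ². Let 0 < r₁ < r, 0 < ρ₁ < ρ and M > 0 be such that |f(z,w)| ≤ M whenever |z| ≤ r₁ and |w| ≤ ρ₁. Then there exists a function w₁ holomorphic on the open disk {|z| < r₁·(1 − exp(−ρ₁/(2·M·r₁)))} such that w₁(0) = 0, |w₁(z)| < ρ₁ on this disk, and w₁′(z) = f(z, w₁(z)) for every z in this disk. -/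
/-- **Quantitative Cauchy existence theorem** for the complex ODE `w' = f(z, w)`.
If `f` is holomorphic on the polydisk `{|z| < r} × {|w| < ρ}` and bounded by `M` on
`{|z| ≤ r₁} × {|w| ≤ ρ₁}`, then there is a holomorphic solution `w₁` with `w₁ 0 = 0`
on the disk of radius `r₁ * (1 - exp (-ρ₁ / (2 * M * r₁)))`. -/
theorem cauchy_quantitative_existence
    (r ρ r₁ ρ₁ M : ℝ) (hρ : 0 < ρ) (hr : 0 < r)
    (hr₁ : 0 < r₁) (hr₁r : r₁ < r) (hρ₁ : 0 < ρ₁) (hρ₁ρ : ρ₁ < ρ) (hM : 0 < M)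
    (f : ℂ × ℂ → ℂ)
    (hf : DifferentiableOn ℂ f {p : ℂ × ℂ | ‖p.1‖ < r ∧ ‖p.2‖ < ρ})
    (hbound : ∀ z w : ℂ, ‖z‖ ≤ r₁ → ‖w‖ ≤ ρ₁ → ‖f (z, w)‖ ≤ M) :
    ∃ w₁ : ℂ → ℂ, w₁ 0 = 0 ∧
      ∀ z : ℂ, ‖z‖ < r₁ * (1 - Real.exp (-ρ₁ / (2 * M * r₁))) →
        ‖w₁ z‖ < ρ₁ ∧ HasDerivAt w₁ (f (z, w₁ z)) z := by
  set R : ℝ := r₁ * (1 - Real.exp (-ρ₁ / (2 * M * r₁))) with hR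
  have hx : 0 < ρ₁ / (2 * M * r₁) := by positivity
  have hneg : -ρ₁ / (2 * M * r₁) = -(ρ₁ / (2 * M * r₁)) := by ring
  have hR0 : 0 < R := by
    have : Real.exp (-ρ₁ / (2 * M * r₁)) < 1 := by
      rw [Real.exp_lt_one_iff, hneg]; linarith
    exact mul_pos hr₁ (by linarith)
  have hRr : R < r₁ := by
    have := Real.exp_pos (-ρ₁ / (2 * M * r₁))
    rw [hR]; nlinarith
  have hRM : R < ρ₁ / (2 * M) := by
    have h1 := Real.one_sub_lt_exp_neg hx.ne'
    rw [← hneg] at h1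
    have h2 : r₁ * (1 - Real.exp (-ρ₁ / (2 * M * r₁))) < r₁ * (ρ₁ / (2 * M * r₁)) :=
      mul_lt_mul_of_pos_left (by linarith) hr₁
    have h3 : r₁ * (ρ₁ / (2 * M * r₁)) = ρ₁ / (2 * M) := by field_simp
    rw [hR]; linarith
  have hMR : M * R ≤ ρ₁ / 2 := by
    have := (lt_div_iff₀ (by positivity)).1 hRM
    linarith
  set K : ℝ := M / (ρ₁ / 2) with hK
  have hK0 : 0 < K := by positivity
  set q : ℝ := K * R with hq
  have hq0 : 0 < q := by positivity
  have hq1 : q < 1 := by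
    have := (lt_div_iff₀ (by positivity)).1 hRM
    rw [hq, hK, div_mul_eq_mul_div, div_lt_one (by positivity)]
    linarith
  have hopen : IsOpen {p : ℂ × ℂ | ‖p.1‖ < r ∧ ‖p.2‖ < ρ} := by
    rw [Set.setOf_and]
    exact (isOpen_lt (by fun_prop) (by fun_prop)).inter (isOpen_lt (by fun_prop) (by fun_prop))
  have hfd : ∀ z w : ℂ, ‖z‖ < r → ‖w‖ < ρ → DifferentiableAt ℂ f (z, w) := fun z w hz hw =>
    hf.differentiableAt (hopen.mem_nhds ⟨hz, hw⟩)
  have hsec : ∀ z w : ℂ, ‖z‖ < r → ‖w‖ < ρ → DifferentiableAt ℂ (fun w => f (z, w)) w := by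
    intro z w hz hw
    exact (hfd z w hz hw).comp w (f := fun w => (z, w)) (by fun_prop)
  -- Lipschitz estimate from the Cauchy inequality
  have hlip : ∀ z a b : ℂ, ‖z‖ < r₁ → ‖a‖ ≤ ρ₁ / 2 → ‖b‖ ≤ ρ₁ / 2 →
      ‖f (z, b) - f (z, a)‖ ≤ K * ‖b - a‖ := by
    intro z a b hz ha hb
    refine Convex.norm_image_sub_le_of_norm_deriv_le (𝕜 := ℂ) (f := fun w => f (z, w))
      (s := Metric.closedBall (0 : ℂ) (ρ₁ / 2)) ?_ ?_ (convex_closedBall _ _)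
      (by simpa using ha) (by simpa using hb)
    · intro w hw
      have hw' : ‖w‖ ≤ ρ₁ / 2 := by simpa using hw
      exact hsec z w (by linarith) (by linarith)
    · intro w hw
      have hw' : ‖w‖ ≤ ρ₁ / 2 := by simpa using hw
      have key : ∀ u ∈ Metric.closedBall w (ρ₁ / 2), ‖u‖ ≤ ρ₁ := by
        intro u hu
        have h1 : ‖u - w‖ ≤ ρ₁ / 2 := by simpa [dist_eq_norm] using hu
        have h2 := norm_add_le (u - w) w
        rw [sub_add_cancel] at h2
        linarith
      refine Complex.norm_deriv_le_of_forall_mem_sphere_norm_le (by positivity) ?_ ?_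
      · refine DifferentiableOn.diffContOnCl_ball (U := Metric.closedBall w (ρ₁ / 2)) ?_ le_rfl
        intro u hu
        exact (hsec z u (by linarith) (by linarith [key u hu])).differentiableWithinAt
      · intro u hu
        exact hbound z u hz.le (key u (Metric.sphere_subset_closedBall hu))
  -- one Picard step
  let Good : (ℂ → ℂ) → Prop := fun w => w 0 = 0 ∧ DifferentiableOn ℂ w (Metric.ball 0 R) ∧
    ∀ z ∈ Metric.ball (0 : ℂ) R, ‖w z‖ ≤ ρ₁ / 2
  have h0mem : (0 : ℂ) ∈ Metric.ball (0 : ℂ) R := Metric.mem_ball_self hR0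
  have hstep : ∀ w : ℂ → ℂ, ∃ w' : ℂ → ℂ, Good w → (Good w' ∧
      ∀ z ∈ Metric.ball (0 : ℂ) R, HasDerivAt w' (f (z, w z)) z) := by
    intro w
    by_cases hw : Good w
    swap
    · exact ⟨w, fun h => absurd h hw⟩
    obtain ⟨hw0, hwd, hwb⟩ := hw
    have hd : DifferentiableOn ℂ (fun z => f (z, w z)) (Metric.ball 0 R) := by
      intro z hz
      have hz' : ‖z‖ < R := by simpa using hz
      have hwz := hwd.differentiableAt (Metric.isOpen_ball.mem_nhds hz)
      exact ((hfd z (w z) (by linarith) (by linarith [hwb z hz])).comp z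
        (f := fun z => (z, w z)) (differentiableAt_id.prodMk hwz)).differentiableWithinAt
    obtain ⟨g, hg⟩ := hd.isExactOn_ball
    have hg' : ∀ z ∈ Metric.ball (0 : ℂ) R, HasDerivAt (fun z => g z - g 0) (f (z, w z)) z :=
      fun z hz => (hg z hz).sub_const _
    refine ⟨fun z => g z - g 0, fun _ => ⟨⟨sub_self _,
      fun z hz => (hg' z hz).differentiableAt.differentiableWithinAt, ?_⟩, hg'⟩⟩
    intro z hz
    have hz' : ‖z‖ < R := by simpa using hz
    have := Convex.norm_image_sub_le_of_norm_hasDerivWithin_le (𝕜 := ℂ) (C := M)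
      (fun u hu => (hg u hu).hasDerivWithinAt)
      (fun u hu => by
        have hu' : ‖u‖ < R := by simpa using hu
        exact hbound u (w u) (by linarith) (by linarith [hwb u hu]))
      (convex_ball _ _) h0mem hz
    rw [sub_zero] at this
    have h2 : M * ‖z‖ ≤ M * R := by gcongr
    show ‖g z - g 0‖ ≤ _
    linarith
  choose T hT using hstep
  let W : ℕ → ℂ → ℂ := fun n => T^[n] (fun _ => 0)
  have hWs : ∀ n, W (n + 1) = T (W n) := fun n => Function.iterate_succ_apply' T n _
  have hG : ∀ n, Good (W n) := by
    intro n
    induction n with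
    | zero => exact ⟨rfl, differentiableOn_const _, fun z _ => by simp [W]; positivity⟩
    | succ n ih => rw [hWs]; exact (hT _ ih).1
  have hWd : ∀ n, ∀ z ∈ Metric.ball (0 : ℂ) R, HasDerivAt (W (n + 1)) (f (z, W n z)) z := by
    intro n
    rw [hWs]; exact (hT _ (hG n)).2
  have hdist : ∀ n, ∀ z ∈ Metric.ball (0 : ℂ) R, ‖W (n + 1) z - W n z‖ ≤ ρ₁ / 2 * q ^ n := by
    intro n
    induction n with
    | zero =>
      intro z hz
      simpa [W] using (hG 1).2.2 z hz
    | succ n ih =>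
      intro z hz
      have hz' : ‖z‖ < R := by simpa using hz
      have := Convex.norm_image_sub_le_of_norm_hasDerivWithin_le (𝕜 := ℂ)
        (f := fun z => W (n + 2) z - W (n + 1) z) (C := K * (ρ₁ / 2 * q ^ n))
        (fun u hu => ((hWd (n + 1) u hu).sub (hWd n u hu)).hasDerivWithinAt)
        (fun u hu => by
          have hu' : ‖u‖ < R := by simpa using hu
          refine (hlip u _ _ (by linarith) ((hG n).2.2 u hu) ((hG (n + 1)).2.2 u hu)).trans ?_
          gcongr
          exact ih u hu)
        (convex_ball _ _) h0mem hz
      simp only [(hG _).1, sub_zero] at this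
      refine this.trans ?_
      have : K * (ρ₁ / 2 * q ^ n) * ‖z‖ ≤ K * (ρ₁ / 2 * q ^ n) * R := by gcongr
      refine this.trans (le_of_eq ?_)
      rw [hq]; ring
  have hdist' : ∀ z ∈ Metric.ball (0 : ℂ) R, ∀ n,
      dist (W n z) (W (n + 1) z) ≤ ρ₁ / 2 * q ^ n := by
    intro z hz n
    rw [dist_comm, dist_eq_norm]; exact hdist n z hz
  have hlim : ∀ z, ∃ l, z ∈ Metric.ball (0 : ℂ) R →
      Filter.Tendsto (fun n => W n z) Filter.atTop (nhds l) := by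
    intro z
    by_cases hz : z ∈ Metric.ball (0 : ℂ) R
    · obtain ⟨l, hl⟩ := cauchySeq_tendsto_of_complete
        (cauchySeq_of_le_geometric q (ρ₁ / 2) hq1 (hdist' z hz))
      exact ⟨l, fun _ => hl⟩
    · exact ⟨0, fun h => absurd h hz⟩
  choose w hw using hlim
  have hwb : ∀ z ∈ Metric.ball (0 : ℂ) R, ‖w z‖ ≤ ρ₁ / 2 := fun z hz =>
    le_of_tendsto (hw z hz).norm (Filter.Eventually.of_forall fun n => (hG n).2.2 z hz)
  have hunif : TendstoUniformlyOn (fun n z => f (z, W n z)) (fun z => f (z, w z))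
      Filter.atTop (Metric.ball 0 R) := by
    rw [Metric.tendstoUniformlyOn_iff]
    intro ε hε
    have ht : Filter.Tendsto (fun n : ℕ => K * (ρ₁ / 2 * q ^ n / (1 - q))) Filter.atTop
        (nhds (K * (ρ₁ / 2 * 0 / (1 - q)))) :=
      (((tendsto_pow_atTop_nhds_zero_of_lt_one hq0.le hq1).const_mul _).div_const _).const_mul _
    rw [mul_zero, zero_div, mul_zero] at ht
    filter_upwards [ht.eventually_lt_const hε] with n hn z hz
    have hz' : ‖z‖ < R := by simpa using hz
    have h1 := dist_le_of_le_geometric_of_tendsto q (ρ₁ / 2) hq1 (hdist' z hz) (hw z hz) n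
    rw [dist_comm, dist_eq_norm] at h1
    rw [dist_eq_norm]
    refine lt_of_le_of_lt ((hlip z _ _ (by linarith) ((hG n).2.2 z hz) (hwb z hz)).trans ?_) hn
    gcongr
  refine ⟨w, ?_, ?_⟩
  · refine tendsto_nhds_unique (hw 0 h0mem) ?_
    simp only [(hG _).1]
    exact tendsto_const_nhds
  · intro z hz
    have hz' : z ∈ Metric.ball (0 : ℂ) R := by simpa using hz
    refine ⟨by linarith [hwb z hz'], ?_⟩
    exact hasDerivAt_of_tendstoUniformlyOn (f := fun n => W (n + 1)) Metric.isOpen_ball hunif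
      (Filter.Eventually.of_forall hWd)
      (fun x hx => (hw x hx).comp (Filter.tendsto_add_atTop_nat 1)) hz'
end

section
/- Painlevé's theorem for rational first-order ODEs (no movable essential singularities, single-valued case): let P, Q ∈ ℂ[z][w] be polynomials in w with polynomial coefficients in z, Q ≠ 0, and let z₀ ∈ ℂ be such that (i) the polynomials w ↦ P(z₀,w) and w ↦ Q(z₀,w) have no common root in ℂ, and (ii) the leading coefficients of P and of Q, regarded as polynomials in w with coefficients in ℂ[z], do not vanish at z₀. If w is a function holomorphic on a punctured disk {0 < |z − z₀| < ρ} satisfying Q(z, w(z)) ≠ 0 and w′(z)·Q(z, w(z)) = P(z, w(z)) there, then w is meromorphic at z₀; that is, z₀ is not an essential singularity of w, and w extends to a meromorphic function on the full disk {|z − z₀| < ρ}. -/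
/-- Evaluation of `P ∈ ℂ[z][w]` (a polynomial in `w` whose coefficients are
polynomials in `z`) at the point `(z, w)`. -/
noncomputable def evZW (P : Polynomial (Polynomial ℂ)) (z w : ℂ) : ℂ :=
  (P.map (Polynomial.evalRingHom z)).eval w

open Filter Topology Metric in
lemma meromorphicAt_of_bdd_aux (f : ℂ → ℂ) (z₀ : ℂ) (C : ℝ)
    (hd : ∀ᶠ z in 𝓝[≠] z₀, DifferentiableAt ℂ f z)
    (hb : ∀ᶠ z in 𝓝[≠] z₀, ‖f z‖ ≤ C) : MeromorphicAt f z₀ := by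
  refine ⟨1, ?_⟩
  apply Complex.analyticAt_of_differentiable_on_punctured_nhds_of_continuousAt
  · filter_upwards [hd] with z hz
    simp only [pow_one, smul_eq_mul]
    exact ((differentiableAt_id.sub_const z₀).mul hz)
  · rw [continuousAt_iff_punctured_nhds]
    simp only [pow_one, smul_eq_mul, sub_self, zero_mul]
    have h1 : Tendsto (fun z : ℂ => ‖z - z₀‖ * C) (𝓝[≠] z₀) (𝓝 0) := by
      have : Continuous (fun z : ℂ => ‖z - z₀‖ * C) := by fun_prop
      have h := (this.tendsto z₀).mono_left (nhdsWithin_le_nhds (s := {z₀}ᶜ))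
      simpa using h
    apply squeeze_zero_norm' _ h1
    filter_upwards [hb] with z hz
    rw [norm_mul]
    gcongr

lemma evZW_continuous_aux (P : Polynomial (Polynomial ℂ)) :
    Continuous (fun p : ℂ × ℂ => evZW P p.1 p.2) := by
  have : (fun p : ℂ × ℂ => evZW P p.1 p.2) = fun p : ℂ × ℂ =>
      ∑ i ∈ Finset.range (P.natDegree + 1), (P.coeff i).eval p.1 * p.2 ^ i := by
    funext p
    simp [evZW, Polynomial.eval_map, Polynomial.eval₂_eq_sum_range]
  rw [this]
  refine continuous_finset_sum _ fun i _ => ?_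
  exact ((P.coeff i).continuous.comp continuous_fst).mul (continuous_snd.pow i)

lemma exists_evZW_ne_aux (Q : Polynomial (Polynomial ℂ)) (z₀ : ℂ)
    (h : Q.leadingCoeff.eval z₀ ≠ 0) : ∃ w, evZW Q z₀ w ≠ 0 := by
  by_contra! hc
  have h0 : Q.map (Polynomial.evalRingHom z₀) = 0 := by
    apply Polynomial.funext
    intro r
    simpa [evZW] using hc r
  apply h
  have := congrArg (fun p => p.coeff Q.natDegree) h0
  simpa [Polynomial.coeff_map] using this

open Filter Topology Metric in
/-- Propagation of a bound along a straight segment. -/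
lemma segment_bound_aux (w : ℂ → ℂ) (z₀ w₀ : ℂ) (δ M ε : ℝ) (hε : 0 < ε)
    (hd : ∀ z ∈ ball z₀ δ \ {z₀}, DifferentiableAt ℂ w z)
    (hM : ∀ z ∈ ball z₀ δ \ {z₀}, ‖w z - w₀‖ ≤ ε → ‖deriv w z‖ ≤ M)
    (hsmall : M * (2 * δ) < ε / 2)
    (hM0 : 0 ≤ M)
    (a b : ℂ) (ha : a ∈ ball z₀ δ) (hb : b ∈ ball z₀ δ)
    (hseg : ∀ t : ℝ, a + t * (b - a) ≠ z₀) (haw : ‖w a - w₀‖ ≤ ε / 2) :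
    ‖w b - w₀‖ ≤ ε := by
  have hmem : ∀ t ∈ Set.Icc (0:ℝ) 1, a + (t : ℂ) * (b - a) ∈ ball z₀ δ \ {z₀} := by
    intro t ht
    refine ⟨?_, hseg t⟩
    have := (convex_ball z₀ δ).add_smul_sub_mem ha hb ht
    simpa [Complex.real_smul] using this
  have hder : ∀ t ∈ Set.Icc (0:ℝ) 1, HasDerivAt (fun t : ℝ => w (a + (t : ℂ) * (b - a)) - w₀)
      (deriv w (a + (t : ℂ) * (b - a)) * (b - a)) t := by
    intro t ht
    have h1 := (hd _ (hmem t ht)).hasDerivAt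
    have h2 : HasDerivAt (fun t : ℝ => a + (t : ℂ) * (b - a)) (b - a) t := by
      have := ((Complex.ofRealCLM.hasDerivAt (x := t)).mul_const (b - a)).const_add a
      simpa using this
    exact (h1.comp t h2).sub_const w₀
  have hab : ‖b - a‖ ≤ 2 * δ := by
    rw [← dist_eq_norm]
    have := dist_triangle_right b a z₀
    rw [mem_ball] at ha hb
    linarith
  have key := image_norm_le_of_norm_deriv_right_lt_deriv_boundary (a := 0) (b := 1)
    (f := fun t : ℝ => w (a + (t : ℂ) * (b - a)) - w₀)
    (f' := fun t : ℝ => deriv w (a + (t : ℂ) * (b - a)) * (b - a))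
    (B := fun t => ε / 2 + t * (ε / 2)) (B' := fun _ => ε / 2)
    (fun t ht => (hder t ht).continuousAt.continuousWithinAt)
    (fun t ht => (hder t ⟨ht.1, ht.2.le⟩).hasDerivWithinAt)
    (by simpa using haw)
    (fun t => by simpa using ((hasDerivAt_id t).mul_const (ε / 2)).const_add (ε / 2))
    (by
      intro t ht heq
      have hle : ‖w (a + (t : ℂ) * (b - a)) - w₀‖ ≤ ε := by
        rw [heq]
        nlinarith [ht.1, ht.2]
      have h1 := hM _ (hmem t ⟨ht.1, ht.2.le⟩) hle
      calc _ = ‖deriv w (a + (t : ℂ) * (b - a))‖ * ‖b - a‖ := norm_mul _ _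
        _ ≤ M * (2 * δ) := by gcongr
        _ < ε / 2 := hsmall)
  have := key (x := 1) ⟨by norm_num, le_refl _⟩
  simp only [Complex.ofReal_one, one_mul, add_sub_cancel] at this
  linarith

open Filter Topology Metric in
lemma ball_bound_aux (w : ℂ → ℂ) (z₀ w₀ : ℂ) (δ M ε : ℝ) (hε : 0 < ε)
    (hd : ∀ z ∈ ball z₀ δ \ {z₀}, DifferentiableAt ℂ w z)
    (hM : ∀ z ∈ ball z₀ δ \ {z₀}, ‖w z - w₀‖ ≤ ε → ‖deriv w z‖ ≤ M)
    (hsmall : M * (2 * δ) < ε / 2)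
    (hM0 : 0 ≤ M)
    (a : ℂ) (ha : a ∈ ball z₀ δ) (ha0 : a ≠ z₀) (haw : ‖w a - w₀‖ ≤ ε / 2) :
    ∀ b ∈ ball z₀ δ \ {z₀}, ‖w b - w₀‖ ≤ ε := by
  have hh : a - z₀ ≠ 0 := sub_ne_zero.mpr ha0
  have h1 : ∀ k : ℂ, k.im ≠ 0 → z₀ + k * (a - z₀) ∈ ball z₀ δ →
      ‖w (z₀ + k * (a - z₀)) - w₀‖ ≤ ε := by
    intro k hk hb
    refine segment_bound_aux w z₀ w₀ δ M ε hε hd hM hsmall hM0 a _ ha hb ?_ haw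
    intro t ht
    have h2 : (1 - t + t * k) * (a - z₀) = 0 := by linear_combination ht
    rcases mul_eq_zero.mp h2 with h3 | h3
    · have him := congrArg Complex.im h3
      have hre := congrArg Complex.re h3
      simp at him hre
      rcases him with h | h
      · subst h
        simp at hre
      · exact hk h
    · exact hh h3
  intro b hb
  obtain ⟨k, rfl⟩ : ∃ k : ℂ, b = z₀ + k * (a - z₀) :=
    ⟨(b - z₀) / (a - z₀), by field_simp; ring⟩
  by_cases hk : k.im = 0
  · have hc : Tendsto (fun s : ℝ => z₀ + (k + s * Complex.I) * (a - z₀)) (𝓝[≠] 0)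
        (𝓝 (z₀ + k * (a - z₀))) := by
      have : Continuous (fun s : ℝ => z₀ + (k + s * Complex.I) * (a - z₀)) := by fun_prop
      have h := (this.tendsto 0).mono_left (nhdsWithin_le_nhds (s := {0}ᶜ))
      simpa using h
    have hw := (((hd _ hb).continuousAt.tendsto.comp hc).sub_const w₀).norm
    refine le_of_tendsto hw ?_
    filter_upwards [hc.eventually (isOpen_ball.mem_nhds hb.1), self_mem_nhdsWithin] with s hs hs0
    refine h1 _ ?_ hs
    simpa [hk] using hs0
  · exact h1 k hk hb.1

/-- **Painlevé's theorem** for rational first-order ODEs (no movable essential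
singularities, single-valued case).  If `z₀` lies outside the exceptional set of the
equation `w' = P(z, w) / Q(z, w)` — i.e. `P(z₀, ·)` and `Q(z₀, ·)` have no common root
and the leading coefficients of `P` and `Q` (as polynomials in `w`) do not vanish at
`z₀` — then any solution holomorphic on a punctured disk around `z₀` is meromorphic at
`z₀` and extends to a meromorphic function on the full disk. -/
theorem painleve_no_movable_essential_singularities
    (P Q : Polynomial (Polynomial ℂ)) (hQ : Q ≠ 0)
    (z₀ : ℂ) (ρ : ℝ) (hρ : 0 < ρ)
    (hnocommonroot : ∀ w : ℂ, ¬ (evZW P z₀ w = 0 ∧ evZW Q z₀ w = 0))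
    (hleadP : P.leadingCoeff.eval z₀ ≠ 0)
    (hleadQ : Q.leadingCoeff.eval z₀ ≠ 0)
    (w : ℂ → ℂ)
    (hw : DifferentiableOn ℂ w (Metric.ball z₀ ρ \ {z₀}))
    (hQne : ∀ z ∈ Metric.ball z₀ ρ \ {z₀}, evZW Q z (w z) ≠ 0)
    (hode : ∀ z ∈ Metric.ball z₀ ρ \ {z₀},
      deriv w z * evZW Q z (w z) = evZW P z (w z)) :
    MeromorphicAt w z₀ ∧ MeromorphicOn w (Metric.ball z₀ ρ) := by
  classical
  have hopen : IsOpen (Metric.ball z₀ ρ \ {z₀}) := Metric.isOpen_ball.sdiff isClosed_singleton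
  have hda : ∀ z ∈ Metric.ball z₀ ρ \ {z₀}, DifferentiableAt ℂ w z :=
    fun z hz => hw.differentiableAt (hopen.mem_nhds hz)
  suffices hmain : MeromorphicAt w z₀ by
    refine ⟨hmain, fun z hz => ?_⟩
    by_cases h : z = z₀
    · exact h ▸ hmain
    · exact (hw.analyticAt (hopen.mem_nhds ⟨hz, h⟩)).meromorphicAt
  have hev : ∀ᶠ z in nhdsWithin z₀ {z₀}ᶜ, z ∈ Metric.ball z₀ ρ \ {z₀} := by
    filter_upwards [nhdsWithin_le_nhds (Metric.ball_mem_nhds z₀ hρ), self_mem_nhdsWithin]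
      with z h1 h2 using ⟨h1, h2⟩
  obtain ⟨w₀, hw₀⟩ := exists_evZW_ne_aux Q z₀ hleadQ
  have hF : ContinuousAt (fun p : ℂ × ℂ => ‖evZW P p.1 p.2 / evZW Q p.1 p.2‖) (z₀, w₀) :=
    ((evZW_continuous_aux P).continuousAt.div (evZW_continuous_aux Q).continuousAt hw₀).norm
  obtain ⟨M, hM⟩ : ∃ M, ‖evZW P z₀ w₀ / evZW Q z₀ w₀‖ < M := exists_gt _
  have hM0 : 0 ≤ M := (norm_nonneg _).trans hM.le
  obtain ⟨η, hη, hηM⟩ := Metric.eventually_nhds_iff.mp (hF.eventually (gt_mem_nhds hM))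
  set ε := η / 2 with hεdef
  have hε : 0 < ε := by positivity
  by_cases hfreq : ∃ᶠ z in nhdsWithin z₀ {z₀}ᶜ, ‖w z - w₀‖ ≤ ε / 2
  · obtain ⟨δ, hδ, hδρ, hδη, hδM⟩ : ∃ δ > 0, δ ≤ ρ ∧ δ ≤ η ∧ M * (2 * δ) < ε / 2 := by
      refine ⟨min ρ (min η (ε / (8 * (M + 1)))), by positivity, min_le_left _ _,
        (min_le_right _ _).trans (min_le_left _ _), ?_⟩
      have h1 : min ρ (min η (ε / (8 * (M + 1)))) ≤ ε / (8 * (M + 1)) :=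
        (min_le_right _ _).trans (min_le_right _ _)
      calc M * (2 * min ρ (min η (ε / (8 * (M + 1))))) ≤ M * (2 * (ε / (8 * (M + 1)))) := by gcongr
        _ < ε / 2 := by
          rw [← sub_pos]
          have : ε / 2 - M * (2 * (ε / (8 * (M + 1)))) = ε * (M + 2) / (4 * (M + 1)) := by
            field_simp
            ring
          rw [this]
          positivity
    have hsub : Metric.ball z₀ δ \ {z₀} ⊆ Metric.ball z₀ ρ \ {z₀} :=
      Set.diff_subset_diff_left (Metric.ball_subset_ball hδρ)
    have hev' : ∀ᶠ z in nhdsWithin z₀ {z₀}ᶜ, z ∈ Metric.ball z₀ δ \ {z₀} := by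
      filter_upwards [nhdsWithin_le_nhds (Metric.ball_mem_nhds z₀ hδ), self_mem_nhdsWithin]
        with z h1 h2 using ⟨h1, h2⟩
    obtain ⟨a, haw, ha⟩ := (hfreq.and_eventually hev').exists
    have hbd := ball_bound_aux w z₀ w₀ δ M ε hε (fun z hz => hda z (hsub hz)) (by
      intro z hz hzw
      have h1 : deriv w z = evZW P z (w z) / evZW Q z (w z) := by
        rw [eq_div_iff (hQne z (hsub hz))]
        exact hode z (hsub hz)
      rw [h1]
      refine (hηM (y := (z, w z)) ?_).le
      rw [Prod.dist_eq]
      refine max_lt ((Metric.mem_ball.mp hz.1).trans_le hδη) ?_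
      rw [dist_eq_norm]
      simp only
      linarith) hδM hM0 a ha.1 ha.2 haw
    refine meromorphicAt_of_bdd_aux w z₀ (ε + ‖w₀‖) (hev.mono hda) ?_
    filter_upwards [hev'] with z hz
    have := norm_add_le (w z - w₀) w₀
    rw [sub_add_cancel] at this
    linarith [hbd z hz]
  · rw [Filter.not_frequently] at hfreq
    have hg : MeromorphicAt (fun z => (w z - w₀)⁻¹) z₀ := by
      refine meromorphicAt_of_bdd_aux _ z₀ (ε / 2)⁻¹ ?_ ?_
      · filter_upwards [hev, hfreq] with z hz hz2
        refine ((hda z hz).sub_const w₀).inv ?_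
        intro h
        apply hz2
        rw [h]
        simp
        positivity
      · filter_upwards [hfreq] with z hz
        rw [norm_inv]
        exact inv_anti₀ (by positivity) (not_le.mp hz).le
    have h2 := hg.inv.add (MeromorphicAt.const w₀ z₀)
    have h3 : ((fun z => (w z - w₀)⁻¹)⁻¹ + fun _ => w₀) = w := by
      funext z
      simp
    rwa [h3] at h2
end

section
/- Petrović's proposition on leading terms: let x₀ ∈ ℂ be a nonsingular point of the equation, i.e. every φ_i is analytic at x₀ with φ_i(x₀) ≠ 0. Suppose there are integers s ≥ 1 and l ≠ 0, with λ = l/s, and a function u holomorphic on a punctured disk {0 < |t| < r} given there by a convergent series u(t) = Σ_{k ≥ 0} c_k·t^{l+k} with c₀ ≠ 0, such that the function y(x) = u(t) with x = x₀ + t^s satisfies the equation, i.e. Σ_{i=1}^{j} φ_i(x₀ + t^s)·Π_{j'=0}^{n} (δ^{j'}u)(t)^{m_{j'i}} = 0 for 0 < |t| < r, where δ is the operator (δv)(t) = v′(t)/(s·t^{s−1}). Then the leading term c₀(x−x₀)^λ solves the approximate equation corresponding to a vertex or slanted edge of the Petrović polygon: Σ_{i ∈ I} A_i(λ)·c₀^{M_i}·φ_i(x₀)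 = 0, where I is the set of indices i attaining γ_λ = min_{i'} (λ·M_{i'} − N_{i'}). -/
open Finset
open scoped Classical

/-- The descending factorial `λ (λ - 1) ⋯ (λ - p + 1)` (equal to `1` for `p = 0`). -/
noncomputable def descFactorial₀ (lam : ℂ) (p : ℕ) : ℂ :=
  ∏ r ∈ Finset.range p, (lam - r)

/-- A power series converging on a punctured disc is analytic at `0`. -/
lemma petrovic_series_analytic (c : ℕ → ℂ) (r : ℝ) (hr : 0 < r)
    (h : ∀ t : ℂ, 0 < ‖t‖ → ‖t‖ < r → Summable (fun k : ℕ => c k * t ^ k)) :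
    AnalyticAt ℂ (fun t : ℂ => ∑' k : ℕ, c k * t ^ k) 0 := by
  have hsum := h ((r / 2 : ℝ) : ℂ) (by simp; positivity)
    (by rw [Complex.norm_real, Real.norm_of_nonneg (by positivity)]; linarith)
  set p := FormalMultilinearSeries.ofScalars ℂ c with hp
  have hrad : ((r / 2).toNNReal : ENNReal) ≤ p.radius := by
    apply p.le_radius_of_tendsto (l := 0)
    have h1 := hsum.tendsto_atTop_zero.norm
    rw [norm_zero] at h1
    refine h1.congr (fun k => ?_)
    rw [hp, FormalMultilinearSeries.ofScalars_norm, norm_mul, norm_pow, Complex.norm_real,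
      Real.norm_of_nonneg (by positivity : (0:ℝ) ≤ r / 2),
      Real.coe_toNNReal _ (by positivity : (0:ℝ) ≤ r / 2)]
  have hpos : 0 < p.radius := lt_of_lt_of_le (by simpa using hr) hrad
  have h2 := (p.hasFPowerSeriesOnBall hpos).analyticAt
  have h3 : p.sum = (fun t : ℂ => ∑' k : ℕ, c k * t ^ k) := by
    funext t
    simp [FormalMultilinearSeries.sum, hp, mul_comm]
  rwa [h3] at h2

/-- The iterated derivatives `δ^p u` have the expected leading term. -/
lemma petrovic_iterate (s : ℕ) (hs : 1 ≤ s) (l : ℤ) (u g : ℂ → ℂ) (hg : AnalyticAt ℂ g 0)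
    (hu : ∀ᶠ t in nhdsWithin (0 : ℂ) {0}ᶜ, u t = t ^ l * g t) (p : ℕ) :
    ∃ G : ℂ → ℂ, AnalyticAt ℂ G 0 ∧
      G 0 = descFactorial₀ ((l : ℂ) / (s : ℂ)) p * g 0 ∧
      ∀ᶠ t in nhdsWithin (0 : ℂ) {0}ᶜ,
        ((fun (v : ℂ → ℂ) (t : ℂ) =>
              deriv v t / ((s : ℂ) * t ^ (s - 1)))^[p] u t) = t ^ (l - s * p) * G t := by
  have hs0 : (s : ℂ) ≠ 0 := by
    have : s ≠ 0 := by omega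
    exact_mod_cast this
  induction p with
  | zero => exact ⟨g, hg, by simp [descFactorial₀], by simpa using hu⟩
  | succ p ih =>
    obtain ⟨G, hG, hG0, hGe⟩ := ih
    refine ⟨fun t => (((l - s * p : ℤ) : ℂ) * G t + t * deriv G t) / s, ?_, ?_, ?_⟩
    · exact ((analyticAt_const.mul hG).add (analyticAt_id.mul hG.deriv)).div analyticAt_const hs0
    · simp only [descFactorial₀] at hG0 ⊢
      rw [Finset.prod_range_succ, hG0]
      push_cast
      field_simp
      ring
    · have hGan : ∀ᶠ t in nhdsWithin (0 : ℂ) {0}ᶜ, AnalyticAt ℂ G t :=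
        hG.eventually_analyticAt.filter_mono nhdsWithin_le_nhds
      have hne : ∀ᶠ t in nhdsWithin (0 : ℂ) {0}ᶜ, t ≠ 0 := eventually_mem_nhdsWithin
      filter_upwards [eventually_eventually_nhdsWithin.2 hGe, hGan, hne] with t h1 h2 h3
      rw [Function.iterate_succ_apply']
      have h4 : nhdsWithin t {0}ᶜ = nhds t :=
        (isOpen_compl_singleton.nhdsWithin_eq h3)
      rw [h4] at h1
      have h5 := Filter.EventuallyEq.deriv_eq h1
      have h6 : HasDerivAt (fun t : ℂ => t ^ (l - s * p : ℤ) * G t)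
          ((((l - s * p : ℤ) : ℂ) * t ^ ((l - s * p : ℤ) - 1)) * G t
            + t ^ (l - s * p : ℤ) * deriv G t) t :=
        (hasDerivAt_zpow _ t (Or.inl h3)).mul h2.differentiableAt.hasDerivAt
      rw [h6.deriv] at h5
      simp only [h5]
      obtain ⟨q, rfl⟩ : ∃ q, s = q + 1 := ⟨s - 1, by omega⟩
      set a : ℤ := l - ((q + 1 : ℕ) : ℤ) * p with ha
      have e1 : l - ((q + 1 : ℕ) : ℤ) * ((p + 1 : ℕ) : ℤ) = a - 1 - (q : ℤ) := by
        rw [ha]; push_cast; ring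
      have e2 : t ^ a = t ^ (a - 1) * t := by
        rw [← zpow_add_one₀ h3]; congr 1; ring
      have h7 : t ^ q ≠ 0 := pow_ne_zero _ h3
      rw [e1, e2, zpow_sub₀ h3 (a - 1), zpow_natCast, Nat.add_sub_cancel]
      generalize t ^ (a - 1) = w
      generalize (((q + 1 : ℕ) : ℂ)) = S at hs0 ⊢
      field_simp

/-- **Petrović's proposition on leading terms (1894).**  Consider the algebraic ODE
`∑ i, φ i x * ∏ j', (y^{(j')}) ^ (m j' i) = 0` with pairwise distinct exponent
multi-indices, at a nonsingular point `x₀` (all `φ i` analytic and nonzero at `x₀`).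
If it has a Puiseux-series solution `y = ∑_{k ≥ 0} c k (x - x₀)^{(l + k)/s}` with
`c 0 ≠ 0` (written via `x = x₀ + t ^ s`, with `δ v = v' / (s t^{s-1})` replacing
`d/dx`), then its leading term `c₀ (x - x₀)^λ`, `λ = l / s`, solves the approximate
equation `∑_{i ∈ I} A_i(λ) c₀^{M_i} φ_i(x₀) = 0`, the sum being over indices attaining
`min (λ M_i - N_i)` — i.e. over a vertex or slanted edge of the Petrović polygon. -/
theorem petrovic_leading_term
    (n j : ℕ) (hj : 1 ≤ j)
    (m : Fin (n + 1) → Fin j → ℕ)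
    (hm : ∀ i i' : Fin j, (∀ j', m j' i = m j' i') → i = i')
    (φ : Fin j → ℂ → ℂ) (x₀ : ℂ)
    (hφ : ∀ i, AnalyticAt ℂ (φ i) x₀ ∧ φ i x₀ ≠ 0)
    (s : ℕ) (hs : 1 ≤ s) (l : ℤ) (hl : l ≠ 0)
    (r : ℝ) (hr : 0 < r)
    (u : ℂ → ℂ) (c : ℕ → ℂ) (hc0 : c 0 ≠ 0)
    (hdiff : DifferentiableOn ℂ u {t : ℂ | 0 < ‖t‖ ∧ ‖t‖ < r})
    (hconv : ∀ t : ℂ, 0 < ‖t‖ → ‖t‖ < r →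
      HasSum (fun k : ℕ => c k * t ^ (l + (k : ℤ))) (u t))
    (heq : ∀ t : ℂ, 0 < ‖t‖ → ‖t‖ < r →
      ∑ i : Fin j, φ i (x₀ + t ^ s) *
        ∏ j' : Fin (n + 1),
          ((fun (v : ℂ → ℂ) (t : ℂ) =>
              deriv v t / ((s : ℂ) * t ^ (s - 1)))^[(j' : ℕ)] u t) ^ (m j' i) = 0) :
    ∑ i ∈ Finset.univ.filter (fun i : Fin j =>
        ∀ i' : Fin j,
          ((l : ℝ) / s) * (∑ j' : Fin (n + 1), (m j' i : ℝ)) -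
              (∑ j' : Fin (n + 1), ((j' : ℕ) : ℝ) * (m j' i : ℝ)) ≤
          ((l : ℝ) / s) * (∑ j' : Fin (n + 1), (m j' i' : ℝ)) -
              (∑ j' : Fin (n + 1), ((j' : ℕ) : ℝ) * (m j' i' : ℝ))),
      (∏ j' : Fin (n + 1), descFactorial₀ ((l : ℂ) / (s : ℂ)) (j' : ℕ) ^ (m j' i)) *
        c 0 ^ (∑ j' : Fin (n + 1), m j' i) * φ i x₀ = 0 := by
  set g : ℂ → ℂ := fun t => ∑' k : ℕ, c k * t ^ k with hgdef
  have hS : ∀ t : ℂ, 0 < ‖t‖ → ‖t‖ < r →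
      HasSum (fun k : ℕ => c k * t ^ k) (t ^ (-l) * u t) := by
    intro t h0 h1
    have ht : t ≠ 0 := norm_pos_iff.1 h0
    refine ((hconv t h0 h1).mul_left (t ^ (-l))).congr_fun ?_
    intro k
    rw [zpow_add₀ ht, zpow_neg, zpow_natCast]
    have := zpow_ne_zero l ht
    field_simp
  have hg : AnalyticAt ℂ g 0 :=
    petrovic_series_analytic c r hr (fun t h0 h1 => (hS t h0 h1).summable)
  have hg0 : g 0 = c 0 := by
    rw [hgdef]
    simp only
    rw [tsum_eq_single 0 (by intro k hk; simp [hk])]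
    simp
  have hdisc : ∀ᶠ t in nhdsWithin (0 : ℂ) {0}ᶜ, 0 < ‖t‖ ∧ ‖t‖ < r := by
    have h1 : ∀ᶠ t in nhdsWithin (0 : ℂ) {0}ᶜ, t ≠ 0 := eventually_mem_nhdsWithin
    have h2 : ∀ᶠ t in nhdsWithin (0 : ℂ) {0}ᶜ, t ∈ Metric.ball (0 : ℂ) r :=
      nhdsWithin_le_nhds (Metric.ball_mem_nhds _ hr)
    filter_upwards [h1, h2] with t h1 h2
    exact ⟨norm_pos_iff.2 h1, by simpa using h2⟩
  have hu : ∀ᶠ t in nhdsWithin (0 : ℂ) {0}ᶜ, u t = t ^ l * g t := by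
    filter_upwards [hdisc] with t ht
    have ht0 : t ≠ 0 := norm_pos_iff.1 ht.1
    have := (hS t ht.1 ht.2).tsum_eq
    rw [hgdef]
    simp only
    rw [this, ← mul_assoc, ← zpow_add₀ ht0]
    simp
  choose G hGa hG0 hGe using petrovic_iterate s hs l u g hg hu
  set e : Fin j → ℤ := fun i =>
    l * (∑ j' : Fin (n + 1), (m j' i : ℤ)) -
      s * (∑ j' : Fin (n + 1), ((j' : ℕ) : ℤ) * (m j' i : ℤ)) with he
  have hspos : (0 : ℝ) < s := by exact_mod_cast hs
  have hiff : ∀ i i' : Fin j,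
      (((l : ℝ) / s) * (∑ j' : Fin (n + 1), (m j' i : ℝ)) -
              (∑ j' : Fin (n + 1), ((j' : ℕ) : ℝ) * (m j' i : ℝ)) ≤
          ((l : ℝ) / s) * (∑ j' : Fin (n + 1), (m j' i' : ℝ)) -
              (∑ j' : Fin (n + 1), ((j' : ℕ) : ℝ) * (m j' i' : ℝ))) ↔ e i ≤ e i' := by
    intro i i'
    have key : ∀ i, ((e i : ℤ) : ℝ) = s * (((l : ℝ) / s) * (∑ j' : Fin (n + 1), (m j' i : ℝ)) -
              (∑ j' : Fin (n + 1), ((j' : ℕ) : ℝ) * (m j' i : ℝ))) := by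
      intro i
      rw [he]
      push_cast
      field_simp
    rw [← @Int.cast_le ℝ, key, key, mul_le_mul_iff_right₀ hspos]
  simp only [hiff]
  have : Nonempty (Fin j) := ⟨⟨0, hj⟩⟩
  obtain ⟨i0, hi0⟩ := Finite.exists_min e
  set H : Fin j → ℂ → ℂ := fun i t =>
    φ i (x₀ + t ^ s) * ∏ j' : Fin (n + 1), G (j' : ℕ) t ^ (m j' i) with hH
  have hHc : ∀ i, ContinuousAt (H i) 0 := by
    intro i
    have h1 : ContinuousAt (fun t : ℂ => φ i (x₀ + t ^ s)) 0 := by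
      apply ContinuousAt.comp (g := φ i) (f := fun t : ℂ => x₀ + t ^ s)
      · have : x₀ + (0 : ℂ) ^ s = x₀ := by
          rw [zero_pow (by omega), add_zero]
        rw [this]
        exact (hφ i).1.continuousAt
      · fun_prop
    refine h1.mul ?_
    exact tendsto_finsetProd _ (fun j' _ => ((hGa j').continuousAt.pow _))
  have hcont : ContinuousAt (fun t : ℂ => ∑ i, t ^ (e i - e i0).toNat * H i t) 0 :=
    tendsto_finsetSum _ (fun i _ => (continuousAt_id.pow _).mul (hHc i))
  have hall : ∀ᶠ t in nhdsWithin (0 : ℂ) {0}ᶜ, ∀ j' : Fin (n + 1),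
      ((fun (v : ℂ → ℂ) (t : ℂ) =>
              deriv v t / ((s : ℂ) * t ^ (s - 1)))^[(j' : ℕ)] u t)
        = t ^ (l - s * (j' : ℕ)) * G j' t :=
    Filter.eventually_all.2 (fun j' => hGe j')
  have hzero : ∀ᶠ t in nhdsWithin (0 : ℂ) {0}ᶜ,
      ∑ i, t ^ (e i - e i0).toNat * H i t = 0 := by
    filter_upwards [hdisc, hall] with t ht h1
    have ht0 : t ≠ 0 := norm_pos_iff.1 ht.1
    have h2 := heq t ht.1 ht.2
    have h3 : ∀ i, φ i (x₀ + t ^ s) *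
        ∏ j' : Fin (n + 1),
          ((fun (v : ℂ → ℂ) (t : ℂ) =>
              deriv v t / ((s : ℂ) * t ^ (s - 1)))^[(j' : ℕ)] u t) ^ (m j' i)
        = t ^ (e i0) * (t ^ (e i - e i0).toNat * H i t) := by
      intro i
      have h4 : t ^ (e i) = ∏ j' : Fin (n + 1), (t ^ (l - s * (j' : ℕ))) ^ (m j' i) := by
        have h5 : e i = ∑ j' : Fin (n + 1), (l - s * ((j' : ℕ) : ℤ)) * (m j' i : ℤ) := by
          rw [he]
          simp only [sub_mul, Finset.sum_sub_distrib, Finset.mul_sum, mul_assoc]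
        rw [h5]
        have h6 : ∀ S : Finset (Fin (n + 1)),
            t ^ (∑ j' ∈ S, (l - s * ((j' : ℕ) : ℤ)) * (m j' i : ℤ)) =
              ∏ j' ∈ S, (t ^ (l - s * ((j' : ℕ) : ℤ))) ^ (m j' i) := by
          intro S
          induction S using Finset.induction_on with
          | empty => simp
          | insert a S ha ih =>
            rw [Finset.sum_insert ha, Finset.prod_insert ha, zpow_add₀ ht0, ih, zpow_mul,
              zpow_natCast]
        exact h6 _
      have h7 : t ^ (e i0) * t ^ (e i - e i0).toNat = t ^ (e i) := by
        rw [← zpow_natCast, Int.toNat_of_nonneg (sub_nonneg.2 (hi0 i)), ← zpow_add₀ ht0]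
        congr 1
        ring
      rw [← mul_assoc, h7, h4, hH]
      simp only [h1, mul_pow, Finset.prod_mul_distrib]
      ring
    rw [Finset.sum_congr rfl (fun i _ => h3 i), ← Finset.mul_sum] at h2
    exact (mul_eq_zero.1 h2).resolve_left (zpow_ne_zero _ ht0)
  have hlim : ∑ i, (0 : ℂ) ^ (e i - e i0).toNat * H i 0 = 0 := by
    have h1 := hcont.tendsto.mono_left (nhdsWithin_le_nhds (s := {0}ᶜ))
    have h2 : Filter.Tendsto (fun t : ℂ => ∑ i, t ^ (e i - e i0).toNat * H i t)
        (nhdsWithin (0 : ℂ) {0}ᶜ) (nhds 0) :=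
      tendsto_const_nhds.congr' (hzero.mono (fun t ht => ht.symm))
    exact tendsto_nhds_unique h1 h2
  rw [Finset.sum_filter]
  refine Eq.trans ?_ hlim
  refine Finset.sum_congr rfl (fun i _ => ?_)
  by_cases hi : e i = e i0
  · rw [if_pos (fun i' => hi ▸ hi0 i'), hi, hH]
    simp only [hG0, hg0, mul_pow, Finset.prod_mul_distrib, Finset.prod_pow_eq_pow_sum]
    rw [zero_pow (by omega : s ≠ 0)]
    simp
    ring
  · have hlt : e i0 < e i := lt_of_le_of_ne (hi0 i) (Ne.symm hi)
    rw [if_neg (fun h => absurd (h i0) (not_le.2 hlt)), zero_pow (by omega), zero_mul]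
end

section
/- Petrović's theorem on movable poles: the following are equivalent. (a) The poles of the general solution do not depend on the constants of integration: there is no nonsingular point x₀ ∈ U of the equation and no solution of F = 0 with a (possibly critical) pole of some order λ = l/s > 0 at x₀. (b) The Petrović polygon of the equation contains no right slanted edge: there is no λ < 0 and no pair of distinct points Q_i ≠ Q_{i'} with λM_i − N_i = λM_{i'} − N_{i'} = min_{i''}(λM_{i''} − N_{i''}). -/
open scoped Topology

/-- A first-order algebraic ODE `F(x, y, y') = 0` with
`F = ∑ i, φ i x * y ^ (m₀ i) * (y') ^ (m₁ i)`, pairwise distinct exponent pairs,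
and coefficients `φ i` analytic on a domain `U`, none identically zero. -/
structure FirstOrderAlgODE where
  /-- number of monomials -/
  j : ℕ
  hj : 1 ≤ j
  /-- exponent of `y` in the `i`-th monomial -/
  m₀ : Fin j → ℕ
  /-- exponent of `y'` in the `i`-th monomial -/
  m₁ : Fin j → ℕ
  hdistinct : ∀ i i' : Fin j, m₀ i = m₀ i' → m₁ i = m₁ i' → i = i'
  /-- the coefficients -/
  φ : Fin j → ℂ → ℂ
  /-- the domain -/
  U : Set ℂ
  hUopen : IsOpen U
  hUconn : IsPreconnected U
  hUne : U.Nonempty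
  hφ : ∀ i, ∀ x ∈ U, AnalyticAt ℂ (φ i) x
  hφne : ∀ i, ∃ x ∈ U, φ i x ≠ 0

namespace FirstOrderAlgODE

variable (E : FirstOrderAlgODE)

/-- `M i`, the abscissa of the Petrović point `Q i = (M i, N i)`. -/
def M (i : Fin E.j) : ℕ := E.m₀ i + E.m₁ i

/-- `N i`, the ordinate of the Petrović point `Q i = (M i, N i)`. -/
def N (i : Fin E.j) : ℕ := E.m₁ i

/-- `x₀` is a nonsingular point of the equation: it lies in `U` and every coefficient
is analytic and nonvanishing at `x₀`. -/
def Nonsingular (x₀ : ℂ) : Prop :=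
  x₀ ∈ E.U ∧ ∀ i, AnalyticAt ℂ (E.φ i) x₀ ∧ E.φ i x₀ ≠ 0

/-- The Petrović polygon of the equation has an edge with angular coefficient `lam`:
the minimum of `λ M - N` over the points `Q i` is attained at two distinct points. -/
def HasEdge (lam : ℝ) : Prop :=
  ∃ i i' : Fin E.j,
    ((E.M i, E.N i) ≠ (E.M i', E.N i')) ∧
    lam * (E.M i : ℝ) - (E.N i : ℝ) = lam * (E.M i' : ℝ) - (E.N i' : ℝ) ∧
    ∀ i'' : Fin E.j, lam * (E.M i : ℝ) - (E.N i : ℝ) ≤ lam * (E.M i'' : ℝ) - (E.N i'' : ℝ)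

/-- A solution of `F = 0` with a (possibly critical) zero of order `λ = l / s` at `x₀`:
a holomorphic `u` on `{|t| < r}` with `u t = c₀ t ^ l + O(t ^ (l + 1))`, `c₀ ≠ 0`,
solving the equation pulled back along `x = x₀ + t ^ s`. -/
def SolutionWithZero (x₀ : ℂ) (l s : ℕ) : Prop :=
  ∃ r : ℝ, 0 < r ∧ ∃ u : ℂ → ℂ, ∃ c₀ : ℂ, c₀ ≠ 0 ∧
    DifferentiableOn ℂ u (Metric.ball (0 : ℂ) r) ∧
    (fun t : ℂ => u t - c₀ * t ^ l) =O[𝓝[≠] (0 : ℂ)] (fun t : ℂ => t ^ (l + 1)) ∧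
    ∀ t : ℂ, 0 < ‖t‖ → ‖t‖ < r →
      ∑ i : Fin E.j, E.φ i (x₀ + t ^ s) * u t ^ E.m₀ i *
        (deriv u t / ((s : ℂ) * t ^ (s - 1))) ^ E.m₁ i = 0

/-- A solution of `F = 0` with a (possibly critical) pole of order `λ = l / s` at `x₀`:
a holomorphic `u` on the punctured disk `{0 < |t| < r}`, meromorphic at `0` with
`u t = c₀ t ^ (-l) + O(t ^ (-l + 1))`, `c₀ ≠ 0`, solving the equation pulled back along
`x = x₀ + t ^ s`. -/
def SolutionWithPole (x₀ : ℂ) (l s : ℕ) : Prop :=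
  ∃ r : ℝ, 0 < r ∧ ∃ u : ℂ → ℂ, ∃ c₀ : ℂ, c₀ ≠ 0 ∧
    DifferentiableOn ℂ u {t : ℂ | 0 < ‖t‖ ∧ ‖t‖ < r} ∧
    (fun t : ℂ => u t - c₀ * t ^ (-(l : ℤ))) =O[𝓝[≠] (0 : ℂ)]
      (fun t : ℂ => t ^ (-(l : ℤ) + 1)) ∧
    ∀ t : ℂ, 0 < ‖t‖ → ‖t‖ < r →
      ∑ i : Fin E.j, E.φ i (x₀ + t ^ s) * u t ^ E.m₀ i *
        (deriv u t / ((s : ℂ) * t ^ (s - 1))) ^ E.m₁ i = 0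

end FirstOrderAlgODE

namespace Petrovic
open Filter

section Division
variable {E : Type*} [NormedAddCommGroup E] [NormedSpace ℂ E]

/-- the projection `(a, w) ↦ (a, 0)` -/
noncomputable def projL (E : Type*) [NormedAddCommGroup E] [NormedSpace ℂ E] :
    E × ℂ →L[ℂ] E × ℂ :=
  (ContinuousLinearMap.inl ℂ E ℂ).comp (ContinuousLinearMap.fst ℂ E ℂ)

lemma projL_apply (v : E × ℂ) : projL E v = (v.1, 0) := rfl

lemma norm_projL_le : ‖projL E‖ ≤ 1 := by
  refine ContinuousLinearMap.opNorm_le_bound _ zero_le_one fun v => ?_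
  rw [projL_apply, one_mul, Prod.norm_def, Prod.norm_def]
  simp

/-- arguments of the telescoping sum -/
noncomputable def argL (E : Type*) [NormedAddCommGroup E] [NormedSpace ℂ E] {n : ℕ}
    (i : Fin (n + 1)) (j : Fin n) : E × ℂ →L[ℂ] E × ℂ :=
  if j.castSucc < i then projL E else ContinuousLinearMap.id ℂ (E × ℂ)

lemma norm_argL_le {n : ℕ} (i : Fin (n + 1)) (j : Fin n) : ‖argL E i j‖ ≤ 1 := by
  unfold argL
  split_ifs
  · exact norm_projL_le
  · exact ContinuousLinearMap.norm_id_le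

/-- The quotient power series. -/
noncomputable def divSeries (p : FormalMultilinearSeries ℂ (E × ℂ) ℂ) :
    FormalMultilinearSeries ℂ (E × ℂ) ℂ := fun n =>
  ∑ i : Fin (n + 1), ((p (n + 1)).curryMid i ((0 : E), (1 : ℂ))).compContinuousLinearMap
    (fun j => argL E i j)

lemma norm_divSeries_le (p : FormalMultilinearSeries ℂ (E × ℂ) ℂ) (n : ℕ) :
    ‖divSeries p n‖ ≤ (n + 1) * ‖p (n + 1)‖ := by
  unfold divSeries
  refine (norm_sum_le _ _).trans ?_
  have : ∀ i ∈ (Finset.univ : Finset (Fin (n + 1))),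
      ‖((p (n + 1)).curryMid i ((0 : E), (1 : ℂ))).compContinuousLinearMap
        (fun j => argL E i j)‖ ≤ ‖p (n + 1)‖ := by
    intro i _
    refine (ContinuousMultilinearMap.norm_compContinuousLinearMap_le _ _).trans ?_
    have h1 : ‖(p (n + 1)).curryMid i ((0 : E), (1 : ℂ))‖ ≤ ‖p (n + 1)‖ := by
      refine (ContinuousLinearMap.le_opNorm _ _).trans ?_
      rw [ContinuousMultilinearMap.norm_curryMid]
      simp [Prod.norm_def]
    have h2 : ∏ j : Fin n, ‖argL E i j‖ ≤ 1 :=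
      Finset.prod_le_one (fun j _ => norm_nonneg _) (fun j _ => norm_argL_le i j)
    calc _ ≤ ‖p (n + 1)‖ * 1 := mul_le_mul h1 h2 (Finset.prod_nonneg fun j _ => norm_nonneg _)
            (norm_nonneg _)
      _ = _ := mul_one _
  refine (Finset.sum_le_sum this).trans ?_
  simp

lemma divSeries_apply (p : FormalMultilinearSeries ℂ (E × ℂ) ℂ) (n : ℕ) (a : E) (w : ℂ) :
    w * divSeries p n (fun _ => (a, w)) =
      p (n + 1) (fun _ => (a, w)) - p (n + 1) (fun _ => (a, 0)) := by
  set T : ℕ → ℂ := fun i => p (n + 1) (fun j => if (j : ℕ) < i then (a, 0) else (a, w)) with hT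
  have h0 : T 0 = p (n + 1) (fun _ => (a, w)) := by simp [hT]
  have h1 : T (n + 1) = p (n + 1) (fun _ => (a, 0)) := by
    simp only [hT]
    congr 1
    funext j
    simp [j.2]
  rw [← h0, ← h1]
  have h2 := Finset.sum_range_sub' T (n + 1)
  rw [← h2, Finset.sum_range]
  unfold divSeries
  rw [sum_apply, Finset.mul_sum]
  refine Finset.sum_congr rfl fun i _ => ?_
  rw [ContinuousMultilinearMap.compContinuousLinearMap_apply,
    ContinuousMultilinearMap.curryMid_apply]
  set m : Fin (n + 1) → E × ℂ := fun j => if (j : ℕ) < i then (a, 0) else (a, w) with hm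
  have e1 : T i = p (n + 1) (Function.update m i (a, w)) := by
    simp only [hT]
    congr 1
    funext j
    by_cases hj : j = i
    · subst hj; simp
    · simp [Function.update_of_ne hj, hm]
  have e2 : T (i + 1) = p (n + 1) (Function.update m i (a, 0)) := by
    simp only [hT]
    congr 1
    funext j
    by_cases hj : j = i
    · subst hj; simp
    · have : (j : ℕ) ≠ i := fun h => hj (Fin.ext h)
      have h' : ((j : ℕ) < i + 1) ↔ ((j : ℕ) < i) := by omega
      simp [Function.update_of_ne hj, hm, h']
  rw [e1, e2, ← ContinuousMultilinearMap.map_update_sub]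
  have e3 : ((a, w) - (a, 0) : E × ℂ) = w • ((0 : E), (1 : ℂ)) := by simp
  rw [e3, ContinuousMultilinearMap.map_update_smul, smul_eq_mul]
  congr 2
  funext j
  rcases Fin.eq_self_or_eq_succAbove i j with rfl | ⟨k, rfl⟩
  · simp
  · rw [Fin.insertNth_apply_succAbove, Function.update_of_ne (Fin.succAbove_ne i k)]
    simp only [hm, argL]
    by_cases hk : k.castSucc < i
    · rw [if_pos hk, Fin.succAbove_of_castSucc_lt _ _ hk, if_pos (show ((k.castSucc : Fin (n + 1)) : ℕ) < i from hk)]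
      rfl
    · rw [if_neg hk, Fin.succAbove_of_le_castSucc _ _ (not_lt.1 hk), if_neg]
      · rfl
      · have := not_lt.1 hk
        rw [Fin.le_def] at this
        simp at this ⊢
        omega

lemma divSeries_radius_pos (p : FormalMultilinearSeries ℂ (E × ℂ) ℂ) (hp : 0 < p.radius) :
    0 < (divSeries p).radius := by
  obtain ⟨C, r, hC, hr, h⟩ := p.le_mul_pow_of_radius_pos hp
  have hr2 : 0 < (2 * r)⁻¹ := by positivity
  let ρ : NNReal := ⟨(2 * r)⁻¹, hr2.le⟩
  have hρ : 0 < ρ := hr2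
  have : (ρ : ENNReal) ≤ (divSeries p).radius := by
    refine FormalMultilinearSeries.le_radius_of_bound _ (C * r) fun n => ?_
    change ‖divSeries p n‖ * ((2 * r)⁻¹) ^ n ≤ C * r
    have h1 := norm_divSeries_le p n
    have h2 := h (n + 1)
    have h3 : ((n : ℝ) + 1) ≤ 2 ^ n := by
      have := Nat.lt_two_pow_self (n := n)
      exact_mod_cast this
    calc ‖divSeries p n‖ * ((2 * r)⁻¹) ^ n
        ≤ (2 ^ n * (C * r ^ (n + 1))) * ((2 * r)⁻¹) ^ n := by
          gcongr
          refine h1.trans ?_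
          gcongr
      _ = C * r := by
          rw [inv_pow, mul_pow, pow_succ]
          field_simp
  refine lt_of_lt_of_le ?_ this
  exact_mod_cast hρ

/-- Division: an analytic function of `(z, w)` is `f (z, 0) + w * g (z, w)`. -/
theorem exists_division {f : E × ℂ → ℂ} {z₀ : E} (hf : AnalyticAt ℂ f (z₀, 0)) :
    ∃ g : E × ℂ → ℂ, AnalyticAt ℂ g (z₀, 0) ∧
      ∀ᶠ v in 𝓝 ((z₀, 0) : E × ℂ), f v = f (v.1, 0) + v.2 * g v := by
  obtain ⟨p, r, hp⟩ := hf
  have hq := divSeries_radius_pos p (hp.r_pos.trans_le hp.r_le)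
  have hs := (divSeries p).hasFPowerSeriesOnBall hq
  have hs' := hs.comp_sub ((z₀, 0) : E × ℂ)
  rw [zero_add] at hs'
  refine ⟨_, hs'.analyticAt, ?_⟩
  have hb : Metric.eball ((z₀, 0) : E × ℂ) (min r (divSeries p).radius) ∈
      𝓝 ((z₀, 0) : E × ℂ) := Metric.eball_mem_nhds _ (lt_min hp.r_pos hq)
  filter_upwards [hb] with v hv
  obtain ⟨z, w⟩ := v
  have hv' : edist (z, w) ((z₀, 0) : E × ℂ) < min r (divSeries p).radius := hv
  have hv0 : edist (z, (0 : ℂ)) ((z₀, 0) : E × ℂ) < min r (divSeries p).radius := by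
    refine lt_of_le_of_lt ?_ hv'
    rw [Prod.edist_eq, Prod.edist_eq]
    simp
  have s1 := hp.hasSum_sub (y := (z, w)) (hv'.trans_le (min_le_left _ _))
  have s2 := hp.hasSum_sub (y := (z, (0 : ℂ))) (hv0.trans_le (min_le_left _ _))
  have s3 := hs'.hasSum_sub (y := (z, w)) (hv'.trans_le (min_le_right _ _))
  have s4 := s1.sub s2
  have s5 := s3.mul_left w
  simp only [Prod.mk_sub_mk, sub_zero, divSeries_apply] at s1 s2 s3 s4 s5
  have s6 := (hasSum_nat_add_iff' (f := fun n => p n (fun _ => (z - z₀, w)) - p n (fun _ => (z - z₀, 0))) 1).2 s4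
  have s7 := s5.unique s6
  simp only [Finset.range_one, Finset.sum_singleton] at s7
  have e : p 0 (fun _ => (z - z₀, w)) = p 0 (fun _ => (z - z₀, 0)) := by
    congr 1
    funext j
    exact j.elim0
  rw [e, sub_self, sub_zero] at s7
  simp only [Prod.mk_sub_mk, sub_zero] 
  rw [s7]
  ring

end Division
end Petrovic

namespace Petrovic
open Filter

set_option linter.unusedSectionVars false
section Tools
variable {E : Type*} [NormedAddCommGroup E] [NormedSpace ℂ E]

/-- partial derivatives in the last variable -/
noncomputable def pd (G : E × ℂ → ℂ) (k : ℕ) : E × ℂ → ℂ :=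
  fun v => iteratedDeriv k (fun q => G (v.1, q)) v.2

lemma pd_zero (G : E × ℂ → ℂ) : pd G 0 = G := by
  funext v; simp [pd]

lemma pd_succ (G : E × ℂ → ℂ) (k : ℕ) (v : E × ℂ) :
    pd G (k + 1) v = deriv (fun q => pd G k (v.1, q)) v.2 := by
  simp only [pd, iteratedDeriv_succ]

lemma analyticAt_slice {f : E × ℂ → ℂ} {z : E} {q : ℂ} (hf : AnalyticAt ℂ f (z, q)) :
    AnalyticAt ℂ (fun q => f (z, q)) q :=
  AnalyticAt.fun_comp (g := f) (f := fun q => (z, q)) hf (analyticAt_const.prod analyticAt_id)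

lemma deriv_slice {f : E × ℂ → ℂ} {v : E × ℂ} (hf : AnalyticAt ℂ f v) :
    deriv (fun q => f (v.1, q)) v.2 = fderiv ℂ f v (0, 1) := by
  have h1 : HasFDerivAt f (fderiv ℂ f v) (v.1, v.2) := hf.differentiableAt.hasFDerivAt
  have h2 : HasDerivAt (fun q : ℂ => (v.1, q)) ((0 : E), (1 : ℂ)) v.2 :=
    (hasDerivAt_const _ _).prodMk (hasDerivAt_id _)
  exact (h1.comp_hasDerivAt v.2 h2).deriv

lemma analyticAt_pd {G : E × ℂ → ℂ} {v : E × ℂ} (hG : AnalyticAt ℂ G v) (k : ℕ) :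
    AnalyticAt ℂ (pd G k) v := by
  induction k with
  | zero => rwa [pd_zero]
  | succ k ih =>
    have h1 : AnalyticAt ℂ (fun v => fderiv ℂ (pd G k) v ((0 : E), (1 : ℂ))) v :=
      ((ContinuousLinearMap.apply ℂ ℂ ((0 : E), (1 : ℂ))).analyticAt _).fun_comp ih.fderiv
    refine h1.congr ?_
    filter_upwards [ih.eventually_analyticAt] with w hw
    rw [pd_succ, deriv_slice hw]

/-- one variable -/
lemma iteratedDeriv_top {f H : ℂ → ℂ} {n : ℕ} {c : ℕ → ℂ} (hH : AnalyticAt ℂ H 0)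
    (h : ∀ᶠ q in 𝓝 (0 : ℂ), f q = ∑ k ∈ Finset.range n, c k * q ^ k + q ^ n * H q) :
    iteratedDeriv n f 0 = n.factorial * H 0 := by
  rw [Filter.EventuallyEq.iteratedDeriv_eq n h]
  have hp : ∀ m : ℕ, ContDiffAt ℂ n (fun q : ℂ => q ^ m) 0 := fun m => by fun_prop
  have hH' : ContDiffAt ℂ n H 0 := hH.contDiffAt
  have h1 : ContDiffAt ℂ n (fun q : ℂ => ∑ k ∈ Finset.range n, c k * q ^ k) 0 := by fun_prop
  have h2 : ContDiffAt ℂ n (fun q : ℂ => q ^ n * H q) 0 := (hp n).mul hH'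
  have := iteratedDeriv_add h1 h2
  have e : (fun q : ℂ => ∑ k ∈ Finset.range n, c k * q ^ k + q ^ n * H q) =
      (fun q : ℂ => ∑ k ∈ Finset.range n, c k * q ^ k) + (fun q : ℂ => q ^ n * H q) := rfl
  rw [e, this, iteratedDeriv_fun_mul (hp n) hH', iteratedDeriv_fun_sum (fun i _ => by fun_prop)]
  simp only [iteratedDeriv_const_mul_field, iteratedDeriv_fun_pow_zero]
  rw [Finset.sum_eq_zero, Finset.sum_eq_single n]
  · simp
  · intro b hb hbn; simp [hbn]
  · simp
  · intro k hk
    have : n ≠ k := by have := Finset.mem_range.1 hk; omega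
    simp [this]

lemma analyticAt_zero_slice {f : E × ℂ → ℂ} {z : E} {q : ℂ} (hf : AnalyticAt ℂ f (z, q)) :
    AnalyticAt ℂ (fun z => f (z, q)) z :=
  AnalyticAt.fun_comp (g := f) (f := fun z => (z, q)) hf (analyticAt_id.prod analyticAt_const)

lemma tendsto_fst_const (z : E) (q : ℂ) :
    Tendsto (fun v : E × ℂ => (v.1, q)) (𝓝 (z, q)) (𝓝 (z, q)) := by
  have : Continuous (fun v : E × ℂ => (v.1, q)) := by fun_prop
  exact this.tendsto (z, q)

lemma tendsto_pair_const (z : E) (q : ℂ) :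
    Tendsto (fun z : E => (z, q)) (𝓝 z) (𝓝 (z, q)) := by
  have : Continuous (fun z : E => (z, q)) := by fun_prop
  exact this.tendsto z

/-- Taylor expansion with analytic remainder -/
theorem exists_taylor {f : E × ℂ → ℂ} {z₀ : E} (hf : AnalyticAt ℂ f (z₀, 0)) (n : ℕ) :
    ∃ H : E × ℂ → ℂ, AnalyticAt ℂ H (z₀, 0) ∧
      (∀ᶠ v in 𝓝 ((z₀, 0) : E × ℂ), f v =
        ∑ k ∈ Finset.range n, (pd f k (v.1, 0) / k.factorial) * v.2 ^ k + v.2 ^ n * H v) ∧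
      ∀ᶠ z in 𝓝 z₀, pd f n (z, 0) = n.factorial * H (z, 0) := by
  have key : ∀ n : ℕ, ∀ H : E × ℂ → ℂ, AnalyticAt ℂ H (z₀, 0) →
      (∀ᶠ v in 𝓝 ((z₀, 0) : E × ℂ), f v =
        ∑ k ∈ Finset.range n, (pd f k (v.1, 0) / k.factorial) * v.2 ^ k + v.2 ^ n * H v) →
      ∀ᶠ z in 𝓝 z₀, pd f n (z, 0) = n.factorial * H (z, 0) := by
    intro n H hH h
    have h' := (tendsto_pair_const z₀ (0 : ℂ)).eventually h.eventually_nhds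
    have hH' := (tendsto_pair_const z₀ (0 : ℂ)).eventually hH.eventually_analyticAt
    filter_upwards [h', hH'] with z hz hHz
    have hc : Tendsto (fun q : ℂ => (z, q)) (𝓝 0) (𝓝 (z, 0)) := by
      have : Continuous (fun q : ℂ => (z, q)) := by fun_prop
      exact this.tendsto 0
    exact iteratedDeriv_top (c := fun k => pd f k (z, 0) / k.factorial)
      (analyticAt_slice hHz) (hc.eventually hz)
  induction n with
  | zero =>
    have h0 : (∀ᶠ v in 𝓝 ((z₀, 0) : E × ℂ), f v =
        ∑ k ∈ Finset.range 0, (pd f k (v.1, 0) / k.factorial) * v.2 ^ k + v.2 ^ 0 * f v) := by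
      simp
    exact ⟨f, hf, h0, key 0 f hf h0⟩
  | succ n ih =>
    obtain ⟨H, hH, h1, h2⟩ := ih
    obtain ⟨g, hg, h3⟩ := exists_division hH
    have h4 : (∀ᶠ v in 𝓝 ((z₀, 0) : E × ℂ), f v =
        ∑ k ∈ Finset.range (n + 1), (pd f k (v.1, 0) / k.factorial) * v.2 ^ k
          + v.2 ^ (n + 1) * g v) := by
      have h2' : ∀ᶠ v in 𝓝 ((z₀, 0) : E × ℂ), pd f n (v.1, 0) = n.factorial * H (v.1, 0) :=
        (continuous_fst.tendsto ((z₀, 0) : E × ℂ)).eventually h2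
      filter_upwards [h1, h2', h3] with v hv1 hv2 hv3
      have hfac : (n.factorial : ℂ) ≠ 0 := by exact_mod_cast n.factorial_ne_zero
      rw [hv1, Finset.sum_range_succ, hv2, hv3, mul_div_cancel_left₀ _ hfac]
      ring
    exact ⟨g, hg, h4, key _ g hg h4⟩

/-- order of vanishing along `w = 0` -/
theorem exists_order [CompleteSpace E] {f : E × ℂ → ℂ} {z₀ : E} (hf : AnalyticAt ℂ f (z₀, 0))
    (hne : ¬ ∀ᶠ v in 𝓝 ((z₀, 0) : E × ℂ), f v = 0) :
    ∃ (e : ℕ) (b : E × ℂ → ℂ), AnalyticAt ℂ b (z₀, 0) ∧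
      (∀ᶠ v in 𝓝 ((z₀, 0) : E × ℂ), f v = v.2 ^ e * b v) ∧
      ¬ ∀ᶠ z in 𝓝 z₀, b (z, 0) = 0 := by
  by_contra! hcon
  have hall : ∀ e : ℕ, ∃ b : E × ℂ → ℂ, AnalyticAt ℂ b (z₀, 0) ∧
      (∀ᶠ v in 𝓝 ((z₀, 0) : E × ℂ), f v = v.2 ^ e * b v) := by
    intro e
    induction e with
    | zero => exact ⟨f, hf, by simp⟩
    | succ e ih =>
      obtain ⟨b, hb, h1⟩ := ih
      have h2 := hcon e b hb h1
      obtain ⟨g, hg, h3⟩ := exists_division hb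
      refine ⟨g, hg, ?_⟩
      have h2' : ∀ᶠ v in 𝓝 ((z₀, 0) : E × ℂ), b (v.1, 0) = 0 :=
        (continuous_fst.tendsto ((z₀, 0) : E × ℂ)).eventually h2
      filter_upwards [h1, h2', h3] with v hv1 hv2 hv3
      rw [hv1, hv3, hv2]
      ring
  obtain ⟨δ, hδ, hball⟩ := Metric.eventually_nhds_iff_ball.1 hf.eventually_analyticAt
  apply hne
  refine Metric.eventually_nhds_iff_ball.2 ⟨δ, hδ, fun v hv => ?_⟩
  set d : E × ℂ := v - (z₀, 0) with hd
  let L : ℂ → E × ℂ := fun s => (z₀, 0) + s • d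
  have hLc : Continuous L := by fun_prop
  have hLa : ∀ s, AnalyticAt ℂ L s := fun s => by
    have : Differentiable ℂ L := by fun_prop
    exact this.analyticAt s
  have hL0 : L 0 = (z₀, 0) := by simp [L]
  have hL1 : L 1 = v := by simp [L, hd]
  set V : Set ℂ := L ⁻¹' (Metric.ball (z₀, 0) δ) with hV
  have hVconv : Convex ℝ V := by
    intro s hs t ht a b ha hb hab
    have : L (a • s + b • t) = a • L s + b • L t := by
      simp only [L, add_smul, smul_add]
      rw [add_add_add_comm, ← add_smul a b ((z₀, 0) : E × ℂ), hab, one_smul, smul_assoc,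
        smul_assoc]
    show L _ ∈ Metric.ball (z₀, 0) δ
    rw [this]
    exact convex_ball _ _ hs ht ha hb hab
  have h0V : (0 : ℂ) ∈ V := by
    show L 0 ∈ Metric.ball (z₀, 0) δ
    rw [hL0]; exact Metric.mem_ball_self hδ
  have h1V : (1 : ℂ) ∈ V := by
    show L 1 ∈ Metric.ball (z₀, 0) δ
    rw [hL1]; exact hv
  have hga : AnalyticOnNhd ℂ (fun s => f (L s)) V := fun s hs =>
    AnalyticAt.fun_comp (hball _ hs) (hLa s)
  have hord : analyticOrderAt (fun s => f (L s)) 0 = ⊤ := by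
    rw [ENat.eq_top_iff_forall_ge]
    intro n
    rw [natCast_le_analyticOrderAt (hga 0 h0V)]
    obtain ⟨b, hb, h1⟩ := hall n
    refine ⟨fun s => d.2 ^ n * b (L s), ?_, ?_⟩
    · refine analyticAt_const.mul (AnalyticAt.fun_comp (g := b) (f := L) ?_ (hLa 0))
      rwa [hL0]
    · have ht : Tendsto L (𝓝 0) (𝓝 (z₀, 0)) := by
        have := hLc.tendsto 0
        rwa [hL0] at this
      filter_upwards [ht.eventually h1] with s hs
      rw [hs]
      simp [L, mul_pow]
      ring
  rw [analyticOrderAt_eq_top] at hord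
  have := hga.eqOn_zero_of_preconnected_of_eventuallyEq_zero hVconv.isPreconnected h0V hord h1V
  simpa [hL1] using this

/-- implicit functions -/
theorem exists_implicit [CompleteSpace E] {f : E × ℂ → ℂ} {z₀ : E} {q₀ : ℂ}
    (hf : AnalyticAt ℂ f (z₀, q₀))
    (h0 : f (z₀, q₀) = 0) (hd : deriv (fun q => f (z₀, q)) q₀ ≠ 0) :
    ∃ h : E → ℂ, AnalyticAt ℂ h z₀ ∧ h z₀ = q₀ ∧
      ∀ᶠ v in 𝓝 ((z₀, q₀) : E × ℂ), f v = 0 ↔ h v.1 = v.2 := by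
  have hc : ContDiffAt ℂ ⊤ f (z₀, q₀) := hf.contDiffAt
  have hn : (⊤ : WithTop ℕ∞) ≠ 0 := by simp
  have hi : (fderiv ℂ f (z₀, q₀) ∘L .inr ℂ E ℂ).IsInvertible := by
    have e : fderiv ℂ f (z₀, q₀) ∘L .inr ℂ E ℂ =
        ((ContinuousLinearEquiv.unitsEquivAut ℂ (Units.mk0 _ hd) : ℂ ≃L[ℂ] ℂ) : ℂ →L[ℂ] ℂ) := by
      ext
      have := deriv_slice hf
      simp only at this
      simp [this]
    rw [e]
    exact ⟨_, rfl⟩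
  refine ⟨hc.implicitFunction hn hi, (hc.contDiffAt_implicitFunction hn hi).analyticAt,
    hc.implicitFunction_apply_self hn hi, ?_⟩
  have := hc.eventually_apply_eq_iff_implicitFunction hn hi
  rwa [h0] at this

end Tools

/-- Hurwitz -/
theorem exists_root_near {f : ℂ × ℂ → ℂ} {x₀ q₀ : ℂ} (hf : AnalyticAt ℂ f (x₀, q₀))
    (h0 : f (x₀, q₀) = 0) (hne : ¬ ∀ᶠ q in 𝓝 q₀, f (x₀, q) = 0)
    {W : Set (ℂ × ℂ)} (hW : W ∈ 𝓝 (x₀, q₀)) :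
    ∀ᶠ x in 𝓝 x₀, ∃ q, (x, q) ∈ W ∧ f (x, q) = 0 := by
  obtain ⟨δ, hδ, hball⟩ := Metric.eventually_nhds_iff_ball.1 (hf.eventually_analyticAt.and hW)
  have hball' : ∀ x ∈ Metric.ball x₀ δ, ∀ q ∈ Metric.ball q₀ δ,
      AnalyticAt ℂ f (x, q) ∧ (x, q) ∈ W := by
    intro x hx q hq
    apply hball
    rw [← ball_prod_same]
    exact ⟨hx, hq⟩
  have h1 := (analyticAt_slice hf).eventually_eq_zero_or_eventually_ne_zero.resolve_left hne
  rw [eventually_nhdsWithin_iff, Metric.eventually_nhds_iff_ball] at h1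
  obtain ⟨δ', hδ', h1⟩ := h1
  set ρ := min δ δ' / 2 with hρ
  have hρ0 : 0 < ρ := by positivity
  have hρδ : ρ < δ := by
    have := min_le_left δ δ'
    have : 0 < min δ δ' := by positivity
    rw [hρ]; linarith
  have hρδ' : ρ < δ' := by
    have := min_le_right δ δ'
    have : 0 < min δ δ' := by positivity
    rw [hρ]; linarith
  have hsph : ∀ q ∈ Metric.sphere q₀ ρ, f (x₀, q) ≠ 0 := by
    intro q hq
    have hq' : dist q q₀ = ρ := hq
    refine h1 q ?_ ?_
    · rw [Metric.mem_ball, hq']; exact hρδ'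
    · rintro rfl
      rw [dist_self] at hq'; exact hρ0.ne hq'
  have hsb : Metric.closedBall q₀ ρ ⊆ Metric.ball q₀ δ := Metric.closedBall_subset_ball hρδ
  have hx₀ : x₀ ∈ Metric.ball x₀ δ := Metric.mem_ball_self hδ
  have hcont : ContinuousOn (fun q => ‖f (x₀, q)‖) (Metric.sphere q₀ ρ) := by
    intro q hq
    have := (analyticAt_slice (hball' x₀ hx₀ q (hsb (Metric.sphere_subset_closedBall hq))).1)
    exact this.continuousAt.norm.continuousWithinAt
  have hnes : (Metric.sphere q₀ ρ).Nonempty := NormedSpace.sphere_nonempty.2 hρ0.le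
  obtain ⟨qm, hqm, hmin⟩ := (isCompact_sphere q₀ ρ).exists_isMinOn hnes hcont
  set m := ‖f (x₀, qm)‖ with hm
  have hm0 : 0 < m := norm_pos_iff.2 (hsph qm hqm)
  have hA : ∀ᶠ x in 𝓝 x₀, ∀ q ∈ Metric.sphere q₀ ρ, m / 2 < ‖f (x, q)‖ := by
    refine (isCompact_sphere q₀ ρ).eventually_forall_of_forall_eventually fun q hq => ?_
    have hc : ContinuousAt (fun v : ℂ × ℂ => ‖f v‖) (x₀, q) :=
      (hball' x₀ hx₀ q (hsb (Metric.sphere_subset_closedBall hq))).1.continuousAt.norm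
    refine hc.eventually (lt_mem_nhds ?_)
    have : m ≤ ‖f (x₀, q)‖ := hmin hq
    linarith
  have hB : ∀ᶠ x in 𝓝 x₀, ‖f (x, q₀)‖ < m / 8 := by
    have hc : ContinuousAt (fun x : ℂ => ‖f (x, q₀)‖) x₀ :=
      (analyticAt_zero_slice hf).continuousAt.norm
    refine hc.eventually (gt_mem_nhds ?_)
    simp [h0, hm0]
  filter_upwards [hA, hB, Metric.ball_mem_nhds x₀ hδ] with x hxA hxB hxδ
  have han : AnalyticOnNhd ℂ (fun q => f (x, q)) (Metric.ball q₀ δ) := fun q hq =>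
    analyticAt_slice (hball' x hxδ q hq).1
  have hd : DiffContOnCl ℂ (fun q => f (x, q)) (Metric.ball q₀ ρ) := by
    apply DifferentiableOn.diffContOnCl
    rw [closure_ball q₀ hρ0.ne']
    exact han.differentiableOn.mono hsb
  have hlow : ∀ z ∈ Metric.sphere q₀ ρ, m / 4 ≤ ‖f (x, z) - f (x, q₀)‖ := by
    intro z hz
    have := hxA z hz
    have := norm_sub_norm_le (f (x, z)) (f (x, q₀))
    linarith
  have hfreq : ∃ᶠ z in 𝓝 q₀, f (x, z) ≠ f (x, q₀) := by
    intro hev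
    have hev' : (fun q => f (x, q) - f (x, q₀)) =ᶠ[𝓝 q₀] 0 := by
      filter_upwards [hev] with z hz
      simpa [sub_eq_zero] using hz
    have han' : AnalyticOnNhd ℂ (fun q => f (x, q) - f (x, q₀)) (Metric.ball q₀ δ) :=
      han.sub analyticOnNhd_const
    have := han'.eqOn_zero_of_preconnected_of_eventuallyEq_zero
      (convex_ball q₀ δ).isPreconnected (Metric.mem_ball_self hδ) hev'
      (hsb (Metric.sphere_subset_closedBall hqm))
    have h2 := hlow qm hqm
    simp only [Pi.zero_apply] at this
    rw [this, norm_zero] at h2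
    linarith
  have hsub := hd.ball_subset_image_closedBall hρ0 hlow hfreq
  have h0mem : (0 : ℂ) ∈ Metric.ball (f (x, q₀)) (m / 4 / 2) := by
    rw [Metric.mem_ball, dist_comm, dist_zero_right]
    linarith
  obtain ⟨q, hq, hq0⟩ := hsub h0mem
  exact ⟨q, (hball' x hxδ q (hsb hq)).2, hq0⟩

end Petrovic

namespace Petrovic
open Filter

lemma iteratedDeriv_poly (Q : Polynomial ℂ) (j : ℕ) :
    iteratedDeriv j (fun r => Q.eval r) = fun r => (Polynomial.derivative^[j] Q).eval r := by
  induction j with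
  | zero => simp
  | succ j ih =>
    rw [iteratedDeriv_succ, ih, Function.iterate_succ_apply']
    funext r
    exact Polynomial.deriv _

lemma poly_root (m : ℕ) (β : ℕ → ℂ) (c : ℂ) (hc : c ≠ 0) (hm : β m = 0) (k₀ : ℕ) (hk₀ : k₀ ≤ m)
    (hβ : β k₀ ≠ 0) : ∃ r₀ : ℂ,
      ∑ k ∈ Finset.range (m + 1), β k * r₀ ^ k + r₀ ^ (m + 1) * c = 0 ∧
      ∃ j ≤ m, iteratedDeriv j
        (fun r : ℂ => ∑ k ∈ Finset.range (m + 1), β k * r ^ k + r ^ (m + 1) * c) r₀ ≠ 0 := by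
  set Q : Polynomial ℂ := ∑ k ∈ Finset.range (m + 1), Polynomial.monomial k (β k) +
    Polynomial.monomial (m + 1) c with hQ
  have heval : ∀ r : ℂ, Q.eval r =
      ∑ k ∈ Finset.range (m + 1), β k * r ^ k + r ^ (m + 1) * c := by
    intro r
    simp [hQ, Polynomial.eval_finsetSum, mul_comm]
  have hcoeff : ∀ i, Q.coeff i = (if i < m + 1 then β i else 0) + if i = m + 1 then c else 0 := by
    intro i
    simp [hQ, Polynomial.coeff_monomial, eq_comm]
  have hdeg : Q.natDegree ≤ m + 1 := by
    rw [Polynomial.natDegree_le_iff_coeff_eq_zero]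
    intro i hi
    rw [hcoeff, if_neg (by omega), if_neg (by omega), add_zero]
  have hlead : Q.coeff (m + 1) = c := by simp [hcoeff]
  have hdeg' : Q.natDegree = m + 1 :=
    le_antisymm hdeg (Polynomial.le_natDegree_of_ne_zero (by rwa [hlead]))
  obtain ⟨r₀, hr₀⟩ := IsAlgClosed.exists_root Q (by
    intro h
    have := Polynomial.natDegree_eq_of_degree_eq_some (n := 0) (by simpa using h)
    omega)
  refine ⟨r₀, by rw [← heval]; exact hr₀, ?_⟩
  have hfun : (fun r : ℂ => ∑ k ∈ Finset.range (m + 1), β k * r ^ k + r ^ (m + 1) * c) =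
      fun r => Q.eval r := by
    funext r; rw [heval]
  simp only [hfun, iteratedDeriv_poly]
  by_contra! hcon
  have h1 := hcon m le_rfl
  have hd1 : (Polynomial.derivative^[m] Q).natDegree < 2 := by
    have := Polynomial.natDegree_iterate_derivative Q m
    omega
  rw [Polynomial.eval_eq_sum_range' hd1] at h1
  simp only [Finset.sum_range_succ, Finset.sum_range_zero, Polynomial.coeff_iterate_derivative] at h1
  rw [zero_add m, add_comm 1 m, hlead, hcoeff m] at h1
  simp [hm, hc] at h1
  have hr0 : r₀ = 0 := h1
  have h2 := hcon k₀ hk₀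
  rw [hr0, ← Polynomial.coeff_zero_eq_eval_zero, Polynomial.coeff_iterate_derivative, zero_add,
    hcoeff, if_pos (by omega), if_neg (by omega), Nat.descFactorial_self, add_zero] at h2
  simp [hβ, Nat.factorial_ne_zero] at h2

/-- Induction statement of the parametrized Puiseux theorem. -/
def PP (n : ℕ) : Prop := ∀ (G : (ℂ × ℂ) × ℂ → ℂ) (x₀ q₀ : ℂ), AnalyticAt ℂ G ((x₀, 0), q₀) →
  G ((x₀, 0), q₀) = 0 → (∃ k ≤ n, pd G k ((x₀, 0), q₀) ≠ 0) →
  ∀ W ∈ 𝓝 (x₀, q₀), ∃ (B : ℕ) (x₁ : ℂ) (h : ℂ × ℂ → ℂ), 1 ≤ B ∧ AnalyticAt ℂ h (x₁, 0) ∧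
    (x₁, h (x₁, 0)) ∈ W ∧ ∀ᶠ v in 𝓝 ((x₁, 0) : ℂ × ℂ), G ((v.1, v.2 ^ B), h v) = 0

lemma puiseux_step (m : ℕ) (IH : PP m) (G : (ℂ × ℂ) × ℂ → ℂ) (x₀ : ℂ) (h : ℂ × ℂ → ℂ)
    (hh : AnalyticAt ℂ h (x₀, 0)) (H : (ℂ × ℂ) × ℂ → ℂ) (hH : AnalyticAt ℂ H ((x₀, 0), 0))
    (a : ℕ → ℂ × ℂ → ℂ) (ha : ∀ k, AnalyticAt ℂ (a k) (x₀, 0))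
    (hexp : ∀ᶠ v in 𝓝 (((x₀, 0), 0) : (ℂ × ℂ) × ℂ), G (v.1, h v.1 + v.2) =
      ∑ k ∈ Finset.range (m + 1), a k v.1 * v.2 ^ k + v.2 ^ (m + 1) * H v)
    (hH0 : H ((x₀, 0), 0) ≠ 0)
    (ham : ∀ᶠ v in 𝓝 ((x₀, 0) : ℂ × ℂ), a m v = 0)
    (hax : ∀ k ≤ m, ∀ᶠ x in 𝓝 x₀, a k (x, 0) = 0)
    (ha0 : ¬ ∀ᶠ v in 𝓝 ((x₀, 0) : ℂ × ℂ), a 0 v = 0)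
    (W : Set (ℂ × ℂ)) (hW : W ∈ 𝓝 (x₀, h (x₀, 0))) :
    ∃ (B : ℕ) (x₁ : ℂ) (h : ℂ × ℂ → ℂ), 1 ≤ B ∧ AnalyticAt ℂ h (x₁, 0) ∧
    (x₁, h (x₁, 0)) ∈ W ∧ ∀ᶠ v in 𝓝 ((x₁, 0) : ℂ × ℂ), G ((v.1, v.2 ^ B), h v) = 0 := by
  classical
  have hex : ∀ k, ∃ (e : ℕ) (b : ℂ × ℂ → ℂ), AnalyticAt ℂ b (x₀, 0) ∧
      (∀ᶠ v in 𝓝 ((x₀, 0) : ℂ × ℂ), a k v = v.2 ^ e * b v) ∧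
      ((¬ ∀ᶠ v in 𝓝 ((x₀, 0) : ℂ × ℂ), a k v = 0) → ¬ ∀ᶠ x in 𝓝 x₀, b (x, 0) = 0) ∧
      ((∀ᶠ v in 𝓝 ((x₀, 0) : ℂ × ℂ), a k v = 0) → b = 0) := by
    intro k
    by_cases hk : ∀ᶠ v in 𝓝 ((x₀, 0) : ℂ × ℂ), a k v = 0
    · exact ⟨0, 0, analyticAt_const, by simpa using hk, fun h => absurd hk h, fun _ => rfl⟩
    · obtain ⟨e, b, h1, h2, h3⟩ := exists_order (ha k) hk
      exact ⟨e, b, h1, h2, fun _ => h3, fun h => absurd h hk⟩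
  choose e b hb hab hbS hbN using hex
  set S : Finset ℕ := (Finset.range (m + 1)).filter
    (fun k => ¬ ∀ᶠ v in 𝓝 ((x₀, 0) : ℂ × ℂ), a k v = 0) with hS
  have h0S : 0 ∈ S := Finset.mem_filter.2 ⟨by simp, ha0⟩
  obtain ⟨k₀, hk₀S, hmin⟩ := S.exists_min_image
    (fun k => (e k : ℚ) / ((m + 1 - k : ℕ) : ℚ)) ⟨0, h0S⟩
  have hk₀ := Finset.mem_filter.1 hk₀S
  have hk₀m : k₀ < m + 1 := Finset.mem_range.1 hk₀.1
  set A := e k₀ with hA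
  set B := m + 1 - k₀ with hB
  have hB1 : 1 ≤ B := by omega
  have hineq : ∀ k ∈ S, A * (m + 1 - k) ≤ B * e k := by
    intro k hk
    have hkm : k < m + 1 := Finset.mem_range.1 (Finset.mem_filter.1 hk).1
    have h1 := hmin k hk
    have p1 : (0 : ℚ) < (B : ℕ) := by exact_mod_cast hB1
    have p2 : (0 : ℚ) < ((m + 1 - k : ℕ) : ℚ) := by exact_mod_cast (by omega : 0 < m + 1 - k)
    rw [div_le_div_iff₀ p1 p2] at h1
    have h2 : e k₀ * (m + 1 - k) ≤ e k * B := by exact_mod_cast h1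
    rw [mul_comm B]; exact h2
  have hA1 : 1 ≤ A := by
    by_contra hlt
    have hA0 : e k₀ = 0 := by omega
    apply hbS k₀ hk₀.2
    have h1 := (tendsto_pair_const x₀ (0 : ℂ)).eventually (hab k₀)
    filter_upwards [h1, hax k₀ (by omega)] with x hx1 hx2
    rw [hx2, hA0, pow_zero, one_mul] at hx1
    exact hx1.symm
  set ex : ℕ → ℕ := fun k => B * e k - A * (m + 1 - k) with hex
  have hex0 : ex k₀ = 0 := by simp only [hex]; rw [← hA, ← hB, mul_comm]; simp
  let G' : (ℂ × ℂ) × ℂ → ℂ := fun v =>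
    ∑ k ∈ Finset.range (m + 1), (v.1.2 ^ ex k * b k (v.1.1, v.1.2 ^ B)) * v.2 ^ k +
      v.2 ^ (m + 1) * H ((v.1.1, v.1.2 ^ B), v.1.2 ^ A * v.2)
  have hid : ∀ x σ r : ℂ,
      (G ((x, σ ^ B), h (x, σ ^ B) + σ ^ A * r) =
        ∑ k ∈ Finset.range (m + 1), a k (x, σ ^ B) * (σ ^ A * r) ^ k
          + (σ ^ A * r) ^ (m + 1) * H ((x, σ ^ B), σ ^ A * r)) →
      (∀ k ∈ Finset.range (m + 1), a k (x, σ ^ B) = (σ ^ B) ^ e k * b k (x, σ ^ B)) →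
      G ((x, σ ^ B), h (x, σ ^ B) + σ ^ A * r) = σ ^ (A * (m + 1)) * G' ((x, σ), r) := by
    intro x σ r h1 h2
    rw [h1]
    simp only [G', mul_add, Finset.mul_sum]
    congr 1
    · refine Finset.sum_congr rfl fun k hk => ?_
      rw [h2 k hk]
      by_cases hkS : k ∈ S
      · have hi := hineq k hkS
        have hkm : k < m + 1 := Finset.mem_range.1 hk
        have hexp : B * e k + A * k = A * (m + 1) + ex k := by
          have e1 : A * (m + 1) = A * (m + 1 - k) + A * k := by
            rw [← mul_add]; congr 1; omega
          simp only [hex]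
          omega
        calc (σ ^ B) ^ e k * b k (x, σ ^ B) * (σ ^ A * r) ^ k
            = σ ^ (B * e k + A * k) * b k (x, σ ^ B) * r ^ k := by
              rw [mul_pow, ← pow_mul, ← pow_mul, pow_add]; ring
          _ = _ := by rw [hexp, pow_add]; ring
      · have : b k = 0 := by
          apply hbN
          by_contra hc
          exact hkS (Finset.mem_filter.2 ⟨hk, hc⟩)
        simp [this]
    · rw [mul_pow, ← pow_mul]; ring
  -- the good points
  have hgood : ∀ᶠ x in 𝓝 x₀, (AnalyticAt ℂ h (x, 0) ∧ W ∈ 𝓝 (x, h (x, 0)) ∧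
      AnalyticAt ℂ H ((x, 0), 0) ∧ H ((x, 0), 0) ≠ 0 ∧
      (∀ k ∈ Finset.range (m + 1), AnalyticAt ℂ (b k) (x, 0)) ∧
      (∀ᶠ v in 𝓝 (((x, 0), 0) : (ℂ × ℂ) × ℂ), G (v.1, h v.1 + v.2) =
        ∑ k ∈ Finset.range (m + 1), a k v.1 * v.2 ^ k + v.2 ^ (m + 1) * H v) ∧
      (∀ k ∈ Finset.range (m + 1),
        ∀ᶠ v in 𝓝 ((x, 0) : ℂ × ℂ), a k v = v.2 ^ e k * b k v)) := by
    have t1 := tendsto_pair_const x₀ (0 : ℂ)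
    have t2 : Tendsto (fun x : ℂ => ((x, (0 : ℂ)), (0 : ℂ))) (𝓝 x₀) (𝓝 ((x₀, 0), 0)) := by
      have : Continuous (fun x : ℂ => ((x, (0 : ℂ)), (0 : ℂ))) := by fun_prop
      exact this.tendsto x₀
    have t3 : Tendsto (fun x : ℂ => (x, h (x, 0))) (𝓝 x₀) (𝓝 (x₀, h (x₀, 0))) :=
      (continuousAt_id.prodMk (analyticAt_zero_slice hh).continuousAt)
    refine (t1.eventually hh.eventually_analyticAt).and ((t3.eventually
      (eventually_mem_nhds_iff.2 hW)).and ((t2.eventually hH.eventually_analyticAt).and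
      ((t2.eventually (hH.continuousAt.eventually_ne hH0)).and (Eventually.and ?_
      ((t2.eventually hexp.eventually_nhds).and ?_)))))
    · exact (Finset.eventually_all _).2 fun k _ => t1.eventually (hb k).eventually_analyticAt
    · exact (Finset.eventually_all _).2 fun k _ => t1.eventually (hab k).eventually_nhds
  obtain ⟨x₁, hbx₁, hgx₁⟩ := ((not_eventually.1 (hbS k₀ hk₀.2)).and_eventually
    hgood.eventually_nhds).exists
  obtain ⟨-, -, hHa, hHne, hba, -, -⟩ := hgx₁.self_of_nhds
  have zB : (0 : ℂ) ^ B = 0 := zero_pow (by omega)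
  have zA : (0 : ℂ) ^ A = 0 := zero_pow (by omega)
  obtain ⟨r₀, hr₀, j, hj, hjne⟩ := poly_root m (fun k => (0 : ℂ) ^ ex k * b k (x₁, 0))
    (H ((x₁, 0), 0)) hHne (by simp [hbN m ham]) k₀ (by omega) (by simpa [hex0] using hbx₁)
  have hG'slice : ∀ r, G' ((x₁, 0), r) = ∑ k ∈ Finset.range (m + 1),
      ((0 : ℂ) ^ ex k * b k (x₁, 0)) * r ^ k + r ^ (m + 1) * H ((x₁, 0), 0) := by
    intro r
    simp only [G', zB, zA, zero_mul]
  have hG'a : AnalyticAt ℂ G' ((x₁, 0), r₀) := by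
    have a1 : AnalyticAt ℂ (fun v : (ℂ × ℂ) × ℂ => v.1.1) ((x₁, 0), r₀) :=
      AnalyticAt.fun_comp (g := Prod.fst) analyticAt_fst analyticAt_fst
    have a2 : AnalyticAt ℂ (fun v : (ℂ × ℂ) × ℂ => v.1.2) ((x₁, 0), r₀) :=
      AnalyticAt.fun_comp (g := Prod.snd) analyticAt_snd analyticAt_fst
    have a3 : AnalyticAt ℂ (fun v : (ℂ × ℂ) × ℂ => v.2) ((x₁, 0), r₀) := analyticAt_snd
    refine AnalyticAt.fun_add (Finset.analyticAt_fun_sum _ fun k hk => ?_) ?_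
    · refine ((a2.pow _).mul (AnalyticAt.fun_comp (g := b k) (f := fun v : (ℂ × ℂ) × ℂ => (v.1.1, v.1.2 ^ B)) ?_
        (a1.prod (a2.pow _)))).mul (a3.pow _)
      simp only [zB]
      exact hba k hk
    · refine (a3.pow _).mul (AnalyticAt.fun_comp (g := H) (f := fun v : (ℂ × ℂ) × ℂ =>
        ((v.1.1, v.1.2 ^ B), v.1.2 ^ A * v.2)) ?_
        ((a1.prod (a2.pow _)).prod ((a2.pow _).mul a3)))
      simp only [zB, zA, zero_mul]
      exact hHa
  have hW' : Prod.fst ⁻¹' {x | _} ∈ 𝓝 (x₁, r₀) :=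
    (continuous_fst.tendsto (x₁, r₀)) hgx₁
  obtain ⟨B', x₂, h', hB', hh', hmem, hsol⟩ := IH G' x₁ r₀ hG'a ((hG'slice r₀).trans hr₀)
    ⟨j, hj, by simpa only [pd, hG'slice] using hjne⟩ _ hW'
  obtain ⟨g1, g2, -, -, -, g6, g7⟩ := hmem
  simp only at g1 g2 g6 g7
  have zB' : (0 : ℂ) ^ B' = 0 := zero_pow (by omega)
  have a1 : AnalyticAt ℂ (fun v : ℂ × ℂ => v.1) (x₂, 0) := analyticAt_fst
  have a2 : AnalyticAt ℂ (fun v : ℂ × ℂ => v.2) (x₂, 0) := analyticAt_snd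
  refine ⟨B' * B, x₂, fun v => h (v.1, (v.2 ^ B') ^ B) + (v.2 ^ B') ^ A * h' v,
    Nat.mul_pos hB' hB1, ?_, ?_, ?_⟩
  · refine (AnalyticAt.fun_comp (g := h) (f := fun v : ℂ × ℂ => (v.1, (v.2 ^ B') ^ B)) ?_
      (a1.prod ((a2.pow _).pow _))).add (((a2.pow _).pow _).mul hh')
    simp only [zB, zB']
    exact g1
  · simp only [zB, zB', zA, zero_mul, add_zero]
    exact mem_of_mem_nhds g2
  · have c1 : Tendsto (fun v : ℂ × ℂ => (v.1, (v.2 ^ B') ^ B)) (𝓝 (x₂, 0)) (𝓝 (x₂, 0)) := by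
      have : Continuous (fun v : ℂ × ℂ => (v.1, (v.2 ^ B') ^ B)) := by fun_prop
      have := this.tendsto (x₂, 0)
      simpa only [zB, zB'] using this
    have c2 : Tendsto (fun v : ℂ × ℂ => ((v.1, (v.2 ^ B') ^ B), (v.2 ^ B') ^ A * h' v))
        (𝓝 (x₂, 0)) (𝓝 ((x₂, 0), 0)) := by
      have k1 : ContinuousAt (fun v : ℂ × ℂ => (v.2 ^ B') ^ A * h' v) (x₂, 0) :=
        (((a2.pow _).pow _).mul hh').continuousAt
      have := c1.prodMk_nhds k1
      simpa only [zB', zA, zero_mul] using this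
    have c3 := (Finset.eventually_all (Finset.range (m + 1))).2 fun k hk => c1.eventually (g7 k hk)
    filter_upwards [c2.eventually g6, c3, hsol] with v v1 v2 v3
    have := hid v.1 (v.2 ^ B') (h' v) v1 v2
    rw [pow_mul, this, v3, mul_zero]

end Petrovic

namespace Petrovic
open Filter

lemma not_eventually_zero_of_pd {G : (ℂ × ℂ) × ℂ → ℂ} {z : ℂ × ℂ} {q : ℂ} {n : ℕ}
    (h : pd G n (z, q) ≠ 0) : ¬ ∀ᶠ r in 𝓝 q, G (z, r) = 0 := by
  intro hz
  apply h
  have : (fun r => G (z, r)) =ᶠ[𝓝 q] fun _ => (0 : ℂ) := hz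
  simp only [pd]
  rw [this.iteratedDeriv_eq n]
  simp

theorem puiseux : ∀ n, PP n := by
  intro n
  induction n with
  | zero =>
    rintro G x₀ q₀ hG h0 ⟨k, hk, hne⟩ W hW
    obtain rfl : k = 0 := by omega
    rw [pd_zero] at hne
    exact absurd h0 hne
  | succ m IH =>
    intro G x₀ q₀ hG h0 hk W hW
    by_cases hlow : ∃ k ≤ m, pd G k ((x₀, 0), q₀) ≠ 0
    · exact IH G x₀ q₀ hG h0 hlow W hW
    obtain ⟨k, hk, hkne⟩ := hk
    obtain rfl : k = m + 1 := by
      by_contra hne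
      exact hlow ⟨k, by omega, hkne⟩
    push Not at hlow
    by_cases hstar : ∃ x₁ q₁, AnalyticAt ℂ G ((x₁, 0), q₁) ∧ W ∈ 𝓝 (x₁, q₁) ∧
        G ((x₁, 0), q₁) = 0 ∧ ∃ k ≤ m, pd G k ((x₁, 0), q₁) ≠ 0
    · obtain ⟨x₁, q₁, h1, h2, h3, h4⟩ := hstar
      exact IH G x₁ q₁ h1 h3 h4 W h2
    push Not at hstar
    obtain ⟨h, hh, hhq, hhiff⟩ := exists_implicit (analyticAt_pd hG m) (hlow m le_rfl)
      (by rw [pd_succ] at hkne; exact hkne)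
    -- Hurwitz
    have tE : Tendsto (fun v : ℂ × ℂ => ((v.1, (0 : ℂ)), v.2)) (𝓝 (x₀, q₀)) (𝓝 ((x₀, 0), q₀)) := by
      have : Continuous (fun v : ℂ × ℂ => ((v.1, (0 : ℂ)), v.2)) := by fun_prop
      exact this.tendsto (x₀, q₀)
    have hfa : AnalyticAt ℂ (fun v : ℂ × ℂ => G ((v.1, 0), v.2)) (x₀, q₀) :=
      AnalyticAt.fun_comp (g := G) (f := fun v : ℂ × ℂ => ((v.1, (0 : ℂ)), v.2)) hG
        ((analyticAt_fst.prod analyticAt_const).prod analyticAt_snd)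
    have hW2 : ∀ᶠ v in 𝓝 (x₀, q₀), AnalyticAt ℂ G ((v.1, 0), v.2) ∧ W ∈ 𝓝 v ∧
        (pd G m ((v.1, 0), v.2) = 0 ↔ h (v.1, 0) = v.2) :=
      (tE.eventually hG.eventually_analyticAt).and
        ((eventually_mem_nhds_iff.2 hW).and (tE.eventually hhiff))
    have hroot := exists_root_near hfa h0 (not_eventually_zero_of_pd hkne) hW2
    have hzero : ∀ᶠ x in 𝓝 x₀, ∀ k ≤ m, pd G k ((x, 0), h (x, 0)) = 0 := by
      filter_upwards [hroot] with x hx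
      obtain ⟨q, ⟨g1, g2, g3⟩, g4⟩ := hx
      have hz := hstar x q g1 g2 g4
      have := g3.1 (hz m le_rfl)
      rw [this]
      exact hz
    -- Taylor
    let G' : (ℂ × ℂ) × ℂ → ℂ := fun v => G (v.1, h v.1 + v.2)
    have hG' : AnalyticAt ℂ G' ((x₀, 0), 0) := by
      refine AnalyticAt.fun_comp (g := G) (f := fun v : (ℂ × ℂ) × ℂ => (v.1, h v.1 + v.2)) ?_
        (analyticAt_fst.prod ((AnalyticAt.fun_comp (g := h) (f := Prod.fst) hh
          analyticAt_fst).add analyticAt_snd))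
      simp only [hhq, add_zero]
      exact hG
    have hpd : ∀ k z, pd G' k (z, 0) = pd G k (z, h z) := by
      intro k z
      simp only [pd, G']
      have := iteratedDeriv_comp_const_add k (fun q => G (z, q)) (h z)
      have := congrFun this 0
      simpa using this
    obtain ⟨H, hH, hexp, htop⟩ := exists_taylor hG' (m + 1)
    simp only [hpd] at hexp htop
    have hgr : AnalyticAt ℂ (fun z : ℂ × ℂ => (z, h z)) (x₀, 0) := analyticAt_id.prod hh
    have ha : ∀ k : ℕ, AnalyticAt ℂ (fun z => pd G k (z, h z) / k.factorial) (x₀, 0) := by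
      intro k
      have : AnalyticAt ℂ (fun z => pd G k (z, h z)) (x₀, 0) :=
        AnalyticAt.fun_comp (g := pd G k) (f := fun z : ℂ × ℂ => (z, h z))
          (by rw [hhq]; exact analyticAt_pd hG k) hgr
      exact this.div_const
    have hH0 : H ((x₀, 0), 0) ≠ 0 := by
      have := htop.self_of_nhds
      rw [hhq] at this
      intro hz
      rw [hz, mul_zero] at this
      exact hkne this
    have tgr : Tendsto (fun z : ℂ × ℂ => (z, h z)) (𝓝 (x₀, 0)) (𝓝 ((x₀, 0), q₀)) := by
      have := hgr.continuousAt.tendsto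
      rwa [hhq] at this
    have hWh : W ∈ 𝓝 (x₀, h (x₀, 0)) := by rwa [hhq]
    by_cases ha0 : ∀ᶠ v in 𝓝 ((x₀, 0) : ℂ × ℂ), pd G 0 (v, h v) / (Nat.factorial 0) = 0
    · refine ⟨1, x₀, h, le_rfl, hh, mem_of_mem_nhds hWh, ?_⟩
      filter_upwards [ha0] with v hv
      simpa [pd_zero] using hv
    · refine puiseux_step m IH G x₀ h hh H hH (fun k z => pd G k (z, h z) / k.factorial) ha
        hexp hH0 ?_ ?_ ha0 W hWh
      · filter_upwards [tgr.eventually hhiff] with v hv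
        simp only at hv
        simp [hv]
      · intro k hk
        filter_upwards [hzero] with x hx
        simp [hx k hk]

end Petrovic

namespace Petrovic
open Filter

/-- Holomorphic Picard iteration. -/
theorem exists_ode {R : ℂ × ℂ → ℂ} {x₀ : ℂ} (hR : AnalyticAt ℂ R (x₀, 0)) :
    ∃ X : ℂ → ℂ, X 0 = x₀ ∧ AnalyticAt ℂ X 0 ∧ ∀ᶠ σ in 𝓝 (0 : ℂ), HasDerivAt X (R (X σ, σ)) σ := by
  set C : ℝ := ‖R (x₀, 0)‖ + 1 with hC
  set K : ℝ := ‖fderiv ℂ R (x₀, 0)‖ + 1 with hK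
  have hC0 : 0 < C := by positivity
  have hK0 : 0 < K := by positivity
  have e1 : ∀ᶠ v in 𝓝 (x₀, (0 : ℂ)), ‖R v‖ < C :=
    hR.continuousAt.norm.eventually_lt continuousAt_const (by simp [hC])
  have e2 : ∀ᶠ v in 𝓝 (x₀, (0 : ℂ)), ‖fderiv ℂ R v‖ < K :=
    hR.fderiv.continuousAt.norm.eventually_lt continuousAt_const (by simp [hK])
  obtain ⟨δ, hδ, hb⟩ := Metric.eventually_nhds_iff_ball.1 (hR.eventually_analyticAt.and (e1.and e2))
  have hbA : ∀ v ∈ Metric.ball (x₀, (0 : ℂ)) δ, AnalyticAt ℂ R v := fun v hv => (hb v hv).1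
  have hbC : ∀ v ∈ Metric.ball (x₀, (0 : ℂ)) δ, ‖R v‖ ≤ C := fun v hv => (hb v hv).2.1.le
  have hbK : ∀ v ∈ Metric.ball (x₀, (0 : ℂ)) δ, ‖fderiv ℂ R v‖ ≤ K := fun v hv => (hb v hv).2.2.le
  have hLip : ∀ v ∈ Metric.ball (x₀, (0 : ℂ)) δ, ∀ w ∈ Metric.ball (x₀, (0 : ℂ)) δ,
      ‖R w - R v‖ ≤ K * ‖w - v‖ := fun v hv w hw =>
    Convex.norm_image_sub_le_of_norm_fderiv_le (𝕜 := ℂ)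
      (fun z hz => (hbA z hz).differentiableAt) hbK (convex_ball _ _) hv hw
  set ρ : ℝ := min (δ / 2) (min (δ / (2 * C)) (1 / (2 * K))) with hρ
  have hρ0 : 0 < ρ := by positivity
  have hρ1 : ρ ≤ δ / 2 := min_le_left _ _
  have hρ2 : C * ρ ≤ δ / 2 := by
    have : ρ ≤ δ / (2 * C) := (min_le_right _ _).trans (min_le_left _ _)
    calc C * ρ ≤ C * (δ / (2 * C)) := by gcongr
      _ = δ / 2 := by field_simp
  have hρ3 : K * ρ ≤ 1 / 2 := by
    have : ρ ≤ 1 / (2 * K) := (min_le_right _ _).trans (min_le_right _ _)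
    calc K * ρ ≤ K * (1 / (2 * K)) := by gcongr
      _ = 1 / 2 := by field_simp
  set D := Metric.ball (0 : ℂ) ρ with hD
  have h0D : (0 : ℂ) ∈ D := Metric.mem_ball_self hρ0
  let Good : (ℂ → ℂ) → Prop := fun X => DifferentiableOn ℂ X D ∧ X 0 = x₀ ∧
    ∀ σ ∈ D, ‖X σ - x₀‖ ≤ δ / 2
  have hmem : ∀ X : ℂ → ℂ, (∀ σ ∈ D, ‖X σ - x₀‖ ≤ δ / 2) → ∀ σ ∈ D,
      (X σ, σ) ∈ Metric.ball (x₀, (0 : ℂ)) δ := by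
    intro X hX σ hσ
    rw [Metric.mem_ball, Prod.dist_eq, max_lt_iff]
    constructor
    · have := hX σ hσ
      simp only [dist_eq_norm]
      linarith
    · have : dist σ 0 < ρ := hσ
      simp only
      linarith
  have hstep : ∀ X : {X // Good X}, ∃ Y : {Y // Good Y},
      ∀ σ ∈ D, HasDerivAt Y.1 (R (X.1 σ, σ)) σ := by
    rintro ⟨X, hX1, hX2, hX3⟩
    have hd : DifferentiableOn ℂ (fun σ => R (X σ, σ)) D := by
      intro σ hσ
      have := (hbA _ (hmem X hX3 σ hσ)).differentiableAt
      exact DifferentiableAt.comp_differentiableWithinAt (g := R) σ this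
        ((hX1 σ hσ).prodMk differentiableWithinAt_id)
    obtain ⟨Y, hY0, hY⟩ := hd.isExactOn_ball.with_val_at 0 x₀
    refine ⟨⟨Y, fun σ hσ => (hY σ hσ).differentiableAt.differentiableWithinAt, hY0, ?_⟩, hY⟩
    intro σ hσ
    have := Convex.norm_image_sub_le_of_norm_hasDerivWithin_le
      (fun z hz => (hY z hz).hasDerivWithinAt) (fun z hz => hbC _ (hmem X hX3 z hz))
      (convex_ball (0 : ℂ) ρ) h0D hσ
    rw [hY0, sub_zero] at this
    have hσ' : ‖σ‖ < ρ := by simpa [hD] using hσ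
    calc ‖Y σ - x₀‖ ≤ C * ‖σ‖ := this
      _ ≤ C * ρ := by gcongr
      _ ≤ δ / 2 := hρ2
  choose T hT using hstep
  let X0 : {X // Good X} := ⟨fun _ => x₀, differentiableOn_const _, rfl, fun σ _ => by simp; positivity⟩
  let S : ℕ → {X // Good X} := fun n => T^[n] X0
  have hS : ∀ n, ∀ σ ∈ D, HasDerivAt (S (n + 1)).1 (R ((S n).1 σ, σ)) σ := by
    intro n σ hσ
    have : S (n + 1) = T (S n) := Function.iterate_succ_apply' _ _ _
    rw [this]
    exact hT _ σ hσ
  have hdiff : ∀ n, ∀ σ ∈ D, ‖(S (n + 1)).1 σ - (S n).1 σ‖ ≤ δ * (1 / 2) ^ n := by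
    intro n
    induction n with
    | zero =>
      intro σ hσ
      have := (S (0 + 1)).2.2.2 σ hσ
      have h2 : (S 0).1 σ = x₀ := rfl
      rw [h2]; linarith
    | succ n ih =>
      intro σ hσ
      have := Convex.norm_image_sub_le_of_norm_hasDerivWithin_le
        (f := fun z => (S (n + 1 + 1)).1 z - (S (n + 1)).1 z) (C := K * (δ * (1 / 2) ^ n))
        (fun z hz => ((hS (n + 1) z hz).sub (hS n z hz)).hasDerivWithinAt)
        (fun z hz => by
          refine (hLip _ (hmem _ (S n).2.2.2 z hz) _ (hmem _ (S (n + 1)).2.2.2 z hz)).trans ?_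
          gcongr
          have := ih z hz
          rw [Prod.norm_def]
          simpa using this)
        (convex_ball (0 : ℂ) ρ) h0D hσ
      simp only [(S (n + 1 + 1)).2.2.1, (S (n + 1)).2.2.1, sub_self, sub_zero] at this
      have hσ' : ‖σ‖ < ρ := by simpa [hD] using hσ
      calc _ ≤ K * (δ * (1 / 2) ^ n) * ‖σ‖ := this
        _ ≤ K * (δ * (1 / 2) ^ n) * ρ := by gcongr
        _ = (K * ρ) * (δ * (1 / 2) ^ n) := by ring
        _ ≤ (1 / 2) * (δ * (1 / 2) ^ n) := by gcongr
        _ = _ := by ring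
  have hsum : Summable (fun n : ℕ => δ * (1 / 2 : ℝ) ^ n) :=
    (summable_geometric_of_lt_one (by norm_num) (by norm_num)).mul_left _
  have hunif0 := tendstoUniformlyOn_tsum_nat hsum hdiff
  set L : ℂ → ℂ := fun σ => ∑' n, ((S (n + 1)).1 σ - (S n).1 σ) with hL
  have hunif : TendstoUniformlyOn (fun n σ => (S n).1 σ - (S 0).1 σ) L atTop D := by
    have he : (fun (n : ℕ) (σ : ℂ) => (S n).1 σ - (S 0).1 σ) =
        fun N x => ∑ n ∈ Finset.range N, ((S (n + 1)).1 x - (S n).1 x) := by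
      funext N x
      exact (Finset.sum_range_sub (fun n => (S n).1 x) N).symm
    rw [he]
    exact hunif0
  have hpt0 : ∀ σ ∈ D, Tendsto (fun n => (S n).1 σ - x₀) atTop (𝓝 (L σ)) :=
    fun σ hσ => hunif.tendsto_at hσ
  have hloc := hunif.tendstoLocallyUniformlyOn
  have hdn : ∀ n, DifferentiableOn ℂ (fun σ => (S n).1 σ - (S 0).1 σ) D := fun n =>
    (S n).2.1.sub (S 0).2.1
  have hLd : DifferentiableOn ℂ L D :=
    hloc.differentiableOn (Eventually.of_forall hdn) Metric.isOpen_ball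
  have hder := hloc.deriv (Eventually.of_forall hdn) Metric.isOpen_ball
  set X : ℂ → ℂ := fun σ => x₀ + L σ with hX
  have hpt : ∀ σ ∈ D, Tendsto (fun n => (S n).1 σ) atTop (𝓝 (X σ)) := by
    intro σ hσ
    have := (hpt0 σ hσ).const_add x₀
    simpa [hX] using this
  have hXb : ∀ σ ∈ D, ‖X σ - x₀‖ ≤ δ / 2 := by
    intro σ hσ
    exact le_of_tendsto ((hpt σ hσ).sub_const x₀).norm
      (Eventually.of_forall fun n => (S n).2.2.2 σ hσ)
  have hXd : ∀ σ ∈ D, HasDerivAt X (R (X σ, σ)) σ := by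
    intro σ hσ
    have h1 : HasDerivAt L (deriv L σ) σ :=
      ((hLd σ hσ).differentiableAt (Metric.isOpen_ball.mem_nhds hσ)).hasDerivAt
    have h2 : Tendsto (fun n => deriv (fun σ => (S n).1 σ - (S 0).1 σ) σ) atTop (𝓝 (deriv L σ)) :=
      hder.tendsto_at hσ
    have h3 : Tendsto (fun n => R ((S n).1 σ, σ)) atTop (𝓝 (R (X σ, σ))) :=
      ((hbA _ (hmem X hXb σ hσ)).continuousAt.tendsto).comp ((hpt σ hσ).prodMk_nhds tendsto_const_nhds)
    have h4 := (tendsto_add_atTop_iff_nat 1).2 h2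
    have h5 : ∀ n, deriv (fun σ => (S (n + 1)).1 σ - (S 0).1 σ) σ = R ((S n).1 σ, σ) := by
      intro n
      exact ((hS n σ hσ).sub_const x₀).deriv
    simp only [h5] at h4
    rw [tendsto_nhds_unique h3 h4]
    exact h1.const_add x₀
  refine ⟨X, ?_, ?_, ?_⟩
  · refine tendsto_nhds_unique (hpt 0 h0D) ?_
    simp only [fun n => (S n).2.2.1]
    exact tendsto_const_nhds
  · exact (DifferentiableOn.analyticAt (s := D)
      (fun σ hσ => (hXd σ hσ).differentiableAt.differentiableWithinAt)
      (Metric.isOpen_ball.mem_nhds h0D))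
  · exact Filter.mem_of_superset (Metric.isOpen_ball.mem_nhds h0D) hXd

end Petrovic

namespace Petrovic
open Filter

/-- Local uniformization. -/
theorem exists_uniformizer {X : ℂ → ℂ} {g : ℂ → ℂ} {d : ℕ} (hd : 1 ≤ d) (hX : AnalyticAt ℂ X 0)
    (hg : AnalyticAt ℂ g 0) (hg0 : g 0 ≠ 0)
    (hder : ∀ᶠ σ in 𝓝 (0 : ℂ), HasDerivAt X (σ ^ (d - 1) * g σ) σ) :
    ∃ T w : ℂ → ℂ, AnalyticAt ℂ T 0 ∧ T 0 = 0 ∧ AnalyticAt ℂ w 0 ∧ w 0 ≠ 0 ∧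
      (∀ t, T t = t * w t) ∧ ∀ᶠ t in 𝓝 (0 : ℂ), X (T t) = X 0 + t ^ d := by
  have hord : analyticOrderAt (deriv X) 0 = ((d - 1 : ℕ) : ℕ∞) := by
    rw [hX.deriv.analyticOrderAt_eq_natCast]
    refine ⟨g, hg, hg0, ?_⟩
    filter_upwards [hder] with σ hσ
    simpa using hσ.deriv
  have hord2 := hX.analyticOrderAt_deriv_add_one
  rw [hord] at hord2
  have hXs : AnalyticAt ℂ (fun σ => X σ - X 0) 0 := hX.sub analyticAt_const
  have hord3 : analyticOrderAt (fun σ => X σ - X 0) 0 = (d : ℕ∞) := by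
    rw [← hord2]
    exact_mod_cast (by omega : d - 1 + 1 = d)
  obtain ⟨κ, hκ, hκ0, hXκ⟩ := hXs.analyticOrderAt_eq_natCast.1 hord3
  obtain ⟨c, hc⟩ := IsAlgClosed.exists_pow_nat_eq (κ 0) (n := d) (by omega)
  have hc0 : c ≠ 0 := by
    rintro rfl
    rw [zero_pow (by omega)] at hc
    exact hκ0 hc.symm
  let η : ℂ → ℂ := fun σ => c * Complex.exp (Complex.log (κ σ / κ 0) / d)
  have hη : AnalyticAt ℂ η 0 := by
    have h1 : AnalyticAt ℂ (fun σ => κ σ / κ 0) 0 := hκ.div_const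
    have h2 : AnalyticAt ℂ (fun σ => Complex.log (κ σ / κ 0)) 0 :=
      h1.clog (by simp [div_self hκ0])
    exact analyticAt_const.mul (h2.div_const.cexp)
  have hη0 : η 0 ≠ 0 := by simp [η, hc0]
  have hηd : ∀ᶠ σ in 𝓝 (0 : ℂ), η σ ^ d = κ σ := by
    filter_upwards [hκ.continuousAt.eventually_ne hκ0] with σ hσ
    have hdc : (d : ℂ) ≠ 0 := by exact_mod_cast (by omega : d ≠ 0)
    simp only [η]
    rw [mul_pow, hc, ← Complex.exp_nat_mul, mul_div_cancel₀ _ hdc,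
      Complex.exp_log (div_ne_zero hσ hκ0), mul_div_cancel₀ _ hκ0]
  let ψ : ℂ → ℂ := fun σ => σ * η σ
  have hψ : AnalyticAt ℂ ψ 0 := analyticAt_id.mul hη
  have hψ0 : ψ 0 = 0 := by simp [ψ]
  have hψd : deriv ψ 0 ≠ 0 := by
    have : HasDerivAt ψ (1 * η 0 + 0 * deriv η 0) 0 :=
      (hasDerivAt_id (0 : ℂ)).mul hη.differentiableAt.hasDerivAt
    rw [this.deriv]
    simpa using hη0
  have hst : HasStrictDerivAt ψ (deriv ψ 0) 0 := hψ.hasStrictDerivAt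
  set T := HasStrictDerivAt.localInverse ψ (deriv ψ 0) 0 hst hψd with hT
  have hTa : AnalyticAt ℂ T 0 := by
    have := hψ.analyticAt_localInverse hψd
    rwa [hψ0] at this
  have hT0 : T 0 = 0 := by
    have := HasStrictFDerivAt.localInverse_apply_image (hst.hasStrictFDerivAt_equiv hψd)
    rw [hψ0] at this
    exact this
  have hTinv : ∀ᶠ t in 𝓝 (0 : ℂ), ψ (T t) = t := by
    have := HasStrictFDerivAt.eventually_right_inverse (hst.hasStrictFDerivAt_equiv hψd)
    rw [hψ0] at this
    exact this
  have hTd : HasDerivAt T (deriv ψ 0)⁻¹ 0 := by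
    have := (hst.to_localInverse hψd).hasDerivAt
    rwa [hψ0] at this
  obtain ⟨p, hp⟩ := hTa
  refine ⟨T, dslope T 0, ⟨p, hp⟩, hT0, ⟨_, hp.has_fpower_series_dslope_fslope⟩, ?_, ?_, ?_⟩
  · rw [dslope_same, hTd.deriv]
    exact inv_ne_zero hψd
  · intro t
    have := sub_smul_dslope T 0 t
    simpa [hT0] using this.symm
  · have tt : Tendsto T (𝓝 0) (𝓝 0) := by
      have := hTd.continuousAt.tendsto
      rwa [hT0] at this
    filter_upwards [tt.eventually hXκ, tt.eventually hηd, hTinv] with t h1 h2 h3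
    have : ψ (T t) ^ d = t ^ d := by rw [h3]
    simp only [ψ, mul_pow, h2] at this
    simp only [sub_zero, smul_eq_mul] at h1
    rw [← this, ← h1]
    ring

end Petrovic

namespace Petrovic
open Filter

theorem pole_of_branch (E : FirstOrderAlgODE) (x₁ : ℂ) (hx : E.Nonsingular x₁) (B l s D : ℕ)
    (hB : 1 ≤ B) (hl : 1 ≤ l) (hs : 1 ≤ s) (hD : ∀ i, l * E.M i + s * E.N i ≤ D)
    (h : ℂ × ℂ → ℂ) (hh : AnalyticAt ℂ h (x₁, 0)) (hh0 : h (x₁, 0) ≠ 0)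
    (heq : ∀ᶠ v in 𝓝 ((x₁, 0) : ℂ × ℂ),
      ∑ i, E.φ i v.1 * (v.2 ^ B) ^ (D - (l * E.M i + s * E.N i)) * h v ^ E.N i = 0) :
    E.SolutionWithPole x₁ (B * l) (B * s) := by
  set k := B * l with hk
  set d := B * s with hd
  have hk1 : 1 ≤ k := Nat.mul_pos hB hl
  have hd1 : 1 ≤ d := Nat.mul_pos hB hs
  have hkc : (k : ℂ) ≠ 0 := by exact_mod_cast (by omega : k ≠ 0)
  have hdc : (d : ℂ) ≠ 0 := by exact_mod_cast (by omega : d ≠ 0)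
  obtain ⟨X, hX0, hXa, hXd⟩ := exists_ode (x₀ := x₁) (R := fun v => v.2 ^ (d - 1) * (-k / h v))
    ((analyticAt_snd.pow _).mul (analyticAt_const.div hh hh0))
  have hpair : AnalyticAt ℂ (fun σ => (X σ, σ)) 0 := hXa.prod analyticAt_id
  have hha : AnalyticAt ℂ (fun σ => h (X σ, σ)) 0 :=
    AnalyticAt.fun_comp (g := h) (f := fun σ => (X σ, σ)) (by rw [hX0]; exact hh) hpair
  have hg0 : h (X 0, 0) ≠ 0 := by rwa [hX0]
  obtain ⟨T, w, hTa, hT0, hwa, hw0, hTw, hXT⟩ := exists_uniformizer hd1 hXa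
    (g := fun σ => -k / h (X σ, σ)) (analyticAt_const.div hha hg0)
    (div_ne_zero (neg_ne_zero.2 hkc) hg0) hXd
  have tT : Tendsto T (𝓝 0) (𝓝 0) := by
    have := hTa.continuousAt.tendsto
    rwa [hT0] at this
  have tP : Tendsto (fun t => (X (T t), T t)) (𝓝 0) (𝓝 (x₁, 0)) := by
    have := hpair.continuousAt.tendsto.comp tT
    rwa [hX0] at this
  have hall : ∀ᶠ t in 𝓝 (0 : ℂ), AnalyticAt ℂ T t ∧ w t ≠ 0 ∧
      (∀ᶠ t' in 𝓝 t, X (T t') = X 0 + t' ^ d) ∧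
      HasDerivAt X (T t ^ (d - 1) * (-k / h (X (T t), T t))) (T t) ∧ h (X (T t), T t) ≠ 0 ∧
      ∑ i, E.φ i (X (T t)) * (T t ^ B) ^ (D - (l * E.M i + s * E.N i)) *
        h (X (T t), T t) ^ E.N i = 0 :=
    hTa.eventually_analyticAt.and ((hwa.continuousAt.eventually_ne hw0).and
      (hXT.eventually_nhds.and ((tT.eventually hXd).and
      ((tP.eventually (hh.continuousAt.eventually_ne hh0)).and (tP.eventually heq)))))
  obtain ⟨r, hr, hball⟩ := Metric.eventually_nhds_iff_ball.1 hall
  have hball' : ∀ t : ℂ, ‖t‖ < r → _ := fun t ht => hball t (by simpa using ht)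
  refine ⟨r, hr, fun t => (T t ^ k)⁻¹, (w 0 ^ k)⁻¹, inv_ne_zero (pow_ne_zero _ hw0), ?_, ?_, ?_⟩
  · rintro t ⟨ht0, htr⟩
    obtain ⟨h1, h2, -⟩ := hball' t htr
    have hTne : T t ≠ 0 := by rw [hTw]; exact mul_ne_zero (norm_pos_iff.1 ht0) h2
    exact ((h1.differentiableAt.pow k).inv (pow_ne_zero _ hTne)).differentiableWithinAt
  · have hb : (fun t => (w t ^ k)⁻¹ - (w 0 ^ k)⁻¹) =O[𝓝[≠] (0 : ℂ)] fun t => t := by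
      have := ((hwa.differentiableAt.pow k).inv (pow_ne_zero _ hw0)).isBigO_sub
      simp only [sub_zero] at this
      exact this.mono nhdsWithin_le_nhds
    have hb2 := (Asymptotics.isBigO_refl (fun t : ℂ => t ^ (-(k : ℤ))) (𝓝[≠] (0 : ℂ))).mul hb
    refine hb2.congr' ?_ ?_
    · filter_upwards [self_mem_nhdsWithin] with t ht
      rw [hTw, mul_pow, mul_inv, zpow_neg, zpow_natCast]
      ring
    · filter_upwards [self_mem_nhdsWithin] with t ht
      rw [zpow_add_one₀ ht]
  · intro t ht0 htr
    have htne : t ≠ 0 := norm_pos_iff.1 ht0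
    obtain ⟨h1, h2, h3, h4, h5, h6⟩ := hball' t htr
    have hTne : T t ≠ 0 := by rw [hTw]; exact mul_ne_zero htne h2
    have hXt := h3.self_of_nhds
    have hTd := h1.differentiableAt.hasDerivAt
    have hchain : T t ^ (d - 1) * (-k / h (X (T t), T t)) * deriv T t = d * t ^ (d - 1) := by
      have e1 := h4.comp t hTd
      have e2 : HasDerivAt (fun t' : ℂ => X 0 + t' ^ d) (d * t ^ (d - 1)) t :=
        (hasDerivAt_pow d t).const_add _
      have e3 := e2.congr_of_eventuallyEq h3
      exact e1.unique e3
    have hu : deriv (fun t => (T t ^ k)⁻¹) t / ((d : ℂ) * t ^ (d - 1)) =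
        h (X (T t), T t) / T t ^ (k + d) := by
      have e1 := ((hTd.pow k).inv (pow_ne_zero k hTne)).deriv
      have e1' : deriv (fun t => (T t ^ k)⁻¹) t = -(k * T t ^ (k - 1) * deriv T t) / (T t ^ k) ^ 2 := e1
      rw [e1', ← hchain]
      have hT' : deriv T t ≠ 0 := by
        intro hz
        rw [hz, mul_zero] at hchain
        exact mul_ne_zero hdc (pow_ne_zero _ htne) hchain.symm
      have p1 : T t ^ k = T t ^ (k - 1) * T t := by rw [← pow_succ]; congr 1; omega
      have p2 : T t ^ d = T t ^ (d - 1) * T t := by rw [← pow_succ]; congr 1; omega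
      have p3 : T t ^ (k - 1) ≠ 0 := pow_ne_zero _ hTne
      have p4 : T t ^ (d - 1) ≠ 0 := pow_ne_zero _ hTne
      rw [pow_add, p1, p2]
      generalize T t ^ (k - 1) = a at *
      generalize T t ^ (d - 1) = b at *
      field_simp
    simp only [hu]
    have hmain : T t ^ (B * D) * (∑ i, E.φ i (x₁ + t ^ d) * (T t ^ k)⁻¹ ^ E.m₀ i *
        (h (X (T t), T t) / T t ^ (k + d)) ^ E.m₁ i) = 0 := by
      rw [Finset.mul_sum, ← h6]
      refine Finset.sum_congr rfl fun i _ => ?_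
      have hDi := hD i
      have hsplit : T t ^ (B * D) = (T t ^ B) ^ (D - (l * E.M i + s * E.N i)) *
          ((T t ^ k) ^ E.m₀ i * (T t ^ (k + d)) ^ E.m₁ i) := by
        rw [← pow_mul, ← pow_mul, ← pow_mul, ← pow_add, ← pow_add]
        congr 1
        obtain ⟨c, hc⟩ := Nat.exists_eq_add_of_le hDi
        rw [hc, Nat.add_sub_cancel_left, hk, hd, FirstOrderAlgODE.M, FirstOrderAlgODE.N]
        ring
      rw [hsplit, hXt, hX0, div_pow, inv_pow]
      have q1 : (T t ^ k) ^ E.m₀ i ≠ 0 := pow_ne_zero _ (pow_ne_zero _ hTne)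
      have q2 : (T t ^ (k + d)) ^ E.m₁ i ≠ 0 := pow_ne_zero _ (pow_ne_zero _ hTne)
      simp only [FirstOrderAlgODE.N]
      generalize (T t ^ k) ^ E.m₀ i = a at *
      generalize (T t ^ (k + d)) ^ E.m₁ i = b at *
      field_simp
    exact (mul_eq_zero.1 hmain).resolve_left (pow_ne_zero _ hTne)

end Petrovic

namespace Petrovic
open Filter

lemma exists_nonzero_root (Q : Polynomial ℂ) {a b : ℕ} (hab : a ≠ b) (ha : Q.coeff a ≠ 0)
    (hb : Q.coeff b ≠ 0) : ∃ r, r ≠ 0 ∧ Q.eval r = 0 := by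
  have hQ : Q ≠ 0 := by rintro rfl; simp at ha
  obtain ⟨q, hq, hnd⟩ := Polynomial.exists_eq_pow_rootMultiplicity_mul_and_not_dvd Q hQ 0
  rw [Polynomial.C_0, sub_zero] at hq hnd
  by_cases hdeg : q.degree = 0
  · exfalso
    rw [Polynomial.eq_C_of_degree_eq_zero hdeg] at hq
    rw [hq, Polynomial.coeff_mul_C, Polynomial.coeff_X_pow] at ha hb
    apply hab
    have h1 : a = Q.rootMultiplicity 0 := by by_contra h; simp [h] at ha
    have h2 : b = Q.rootMultiplicity 0 := by by_contra h; simp [h] at hb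
    rw [h1, h2]
  · obtain ⟨r, hr⟩ := IsAlgClosed.exists_root q hdeg
    refine ⟨r, ?_, ?_⟩
    · rintro rfl
      apply hnd
      rw [Polynomial.X_dvd_iff, Polynomial.coeff_zero_eq_eval_zero]
      exact hr
    · rw [hq, Polynomial.eval_mul, hr.eq_zero, mul_zero]

lemma exists_deriv_ne (Q : Polynomial ℂ) (hQ : Q ≠ 0) (r : ℂ) :
    iteratedDeriv Q.natDegree (fun r => Q.eval r) r ≠ 0 := by
  rw [iteratedDeriv_poly]
  have h1 : (Polynomial.derivative^[Q.natDegree] Q).natDegree ≤ 0 := by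
    have := Polynomial.natDegree_iterate_derivative Q Q.natDegree
    omega
  rw [Polynomial.eq_C_of_natDegree_le_zero h1]
  simp only [Polynomial.eval_C, Polynomial.coeff_iterate_derivative, zero_add]
  simp [Nat.descFactorial_self, Nat.factorial_ne_zero, hQ]

lemma nonsingular_eventually (E : FirstOrderAlgODE) {x₀ : ℂ} (h : E.Nonsingular x₀) :
    ∀ᶠ x in 𝓝 x₀, E.Nonsingular x :=
  Filter.Eventually.and (p := fun x => x ∈ E.U) (E.hUopen.mem_nhds h.1) (eventually_all.2 fun i =>
    (h.2 i).1.eventually_analyticAt.and ((h.2 i).1.continuousAt.eventually_ne (h.2 i).2))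

lemma exists_nonsingular (E : FirstOrderAlgODE) : ∃ x₀, E.Nonsingular x₀ := by
  obtain ⟨z, hz⟩ := E.hUne
  have h1 : ∀ i, ∀ᶠ x in 𝓝[≠] z, E.φ i x ≠ 0 := by
    intro i
    by_contra hcon
    have hfreq : ∃ᶠ x in 𝓝[≠] z, E.φ i x = 0 := by
      rw [Filter.not_eventually] at hcon
      simpa only [not_not] using hcon
    have := AnalyticOnNhd.eqOn_zero_of_preconnected_of_frequently_eq_zero (E.hφ i) E.hUconn hz hfreq
    obtain ⟨x, hx, hne⟩ := E.hφne i
    exact hne (this hx)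
  obtain ⟨x, hx, hxU⟩ := ((eventually_all.2 h1).and
    (nhdsWithin_le_nhds (E.hUopen.mem_nhds hz) : ∀ᶠ x in 𝓝[≠] z, x ∈ E.U)).exists
  exact ⟨x, hxU, fun i => ⟨E.hφ i x hxU, hx i⟩⟩

lemma edge_rational (E : FirstOrderAlgODE) {lam : ℝ} (hlam : lam < 0) {i i' : Fin E.j}
    (hne : (E.M i, E.N i) ≠ (E.M i', E.N i'))
    (heq : lam * (E.M i : ℝ) - (E.N i : ℝ) = lam * (E.M i' : ℝ) - (E.N i' : ℝ)) :
    E.N i ≠ E.N i' ∧ ∃ l s : ℕ, 1 ≤ l ∧ 1 ≤ s ∧ lam * s = -l := by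
  have hM : E.M i ≠ E.M i' := by
    intro h
    rw [h] at heq
    have : (E.N i : ℝ) = E.N i' := by linarith
    exact hne (by rw [h, Nat.cast_injective this])
  have key : ∀ i i', E.M i < E.M i' →
      lam * (E.M i : ℝ) - (E.N i : ℝ) = lam * (E.M i' : ℝ) - (E.N i' : ℝ) →
      E.N i' < E.N i ∧ ∃ l s : ℕ, 1 ≤ l ∧ 1 ≤ s ∧ lam * s = -l := by
    intro i i' hlt heq
    have hltR : (E.M i : ℝ) < E.M i' := by exact_mod_cast hlt
    have hN : E.N i' < E.N i := by
      have : (E.N i' : ℝ) < E.N i := by nlinarith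
      exact_mod_cast this
    refine ⟨hN, E.N i - E.N i', E.M i' - E.M i, by omega, by omega, ?_⟩
    rw [Nat.cast_sub hlt.le, Nat.cast_sub hN.le]
    linarith
  rcases lt_or_gt_of_ne hM with h | h
  · obtain ⟨h1, h2⟩ := key i i' h heq
    exact ⟨by omega, h2⟩
  · obtain ⟨h1, h2⟩ := key i' i h heq.symm
    exact ⟨by omega, h2⟩

theorem pole_of_edge (E : FirstOrderAlgODE) {lam : ℝ} (hlam : lam < 0) (hedge : E.HasEdge lam) :
    ∃ (x₀ : ℂ) (l s : ℕ), 1 ≤ l ∧ 1 ≤ s ∧ E.Nonsingular x₀ ∧ E.SolutionWithPole x₀ l s := by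
  obtain ⟨i, i', hne, heq, hmin⟩ := hedge
  obtain ⟨hN, l, s, hl, hs, hls⟩ := edge_rational E hlam hne heq
  have hsR : (0 : ℝ) < s := by exact_mod_cast hs
  have hconv : ∀ a : Fin E.j, (s : ℝ) * (lam * (E.M a : ℝ) - (E.N a : ℝ)) =
      -((l * E.M a + s * E.N a : ℕ) : ℝ) := by
    intro a
    push_cast
    linear_combination (E.M a : ℝ) * hls
  set D := l * E.M i + s * E.N i with hD
  have hDle : ∀ a, l * E.M a + s * E.N a ≤ D := by
    intro a
    have := mul_le_mul_of_nonneg_left (hmin a) hsR.le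
    rw [hconv, hconv] at this
    have h2 : ((l * E.M a + s * E.N a : ℕ) : ℝ) ≤ (D : ℕ) := by linarith
    exact_mod_cast h2
  have hDi' : l * E.M i' + s * E.N i' = D := by
    have := congrArg (fun y => (s : ℝ) * y) heq
    simp only [hconv] at this
    have h2 : ((l * E.M i' + s * E.N i' : ℕ) : ℝ) = (D : ℕ) := by linarith
    exact_mod_cast h2
  obtain ⟨x₀, hx₀⟩ := exists_nonsingular E
  let ex : Fin E.j → ℕ := fun a => D - (l * E.M a + s * E.N a)
  set Q : Polynomial ℂ := ∑ a, Polynomial.monomial (E.N a) (E.φ a x₀ * 0 ^ ex a) with hQ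
  have hQe : ∀ q, Q.eval q = ∑ a, E.φ a x₀ * 0 ^ ex a * q ^ E.N a := by
    intro q
    simp [hQ, Polynomial.eval_finsetSum]
  have hcoeff : ∀ a, l * E.M a + s * E.N a = D → Q.coeff (E.N a) ≠ 0 := by
    intro a ha
    have : Q.coeff (E.N a) = E.φ a x₀ := by
      rw [hQ, Polynomial.finsetSum_coeff, Finset.sum_eq_single a]
      · simp [ex, ha]
      · intro b _ hba
        rw [Polynomial.coeff_monomial]
        split_ifs with hNb
        · have hexb : ex b ≠ 0 := by
            intro hz
            have h1 := hDle b
            have h2 : l * E.M b + s * E.N b = D := by simp only [ex] at hz; omega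
            rw [hNb] at h2
            have h3 : l * E.M b = l * E.M a := by omega
            have h4 := Nat.eq_of_mul_eq_mul_left (by omega) h3
            apply hba
            simp only [FirstOrderAlgODE.M, FirstOrderAlgODE.N] at h4 hNb
            exact E.hdistinct b a (by omega) hNb
          rw [zero_pow hexb, mul_zero]
        · rfl
      · simp
    rw [this]
    exact (hx₀.2 a).2
  obtain ⟨q₀, hq₀, hroot⟩ := exists_nonzero_root Q hN (hcoeff i rfl) (hcoeff i' hDi')
  have hQ0 : Q ≠ 0 := by
    intro h
    apply hcoeff i rfl
    simp [h]
  let G : (ℂ × ℂ) × ℂ → ℂ := fun v => ∑ a, E.φ a v.1.1 * v.1.2 ^ ex a * v.2 ^ E.N a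
  have hG : AnalyticAt ℂ G ((x₀, 0), q₀) := by
    have a1 : AnalyticAt ℂ (fun v : (ℂ × ℂ) × ℂ => v.1.1) ((x₀, 0), q₀) :=
      AnalyticAt.fun_comp (g := Prod.fst) analyticAt_fst analyticAt_fst
    have a2 : AnalyticAt ℂ (fun v : (ℂ × ℂ) × ℂ => v.1.2) ((x₀, 0), q₀) :=
      AnalyticAt.fun_comp (g := Prod.snd) analyticAt_snd analyticAt_fst
    refine Finset.analyticAt_fun_sum _ fun a _ => ?_
    exact ((AnalyticAt.fun_comp (g := E.φ a) (f := fun v : (ℂ × ℂ) × ℂ => v.1.1) (hx₀.2 a).1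
      a1).mul (a2.pow _)).mul (analyticAt_snd.pow _)
  have hGs : ∀ q, G ((x₀, 0), q) = Q.eval q := fun q => (hQe q).symm
  have hW : {v : ℂ × ℂ | E.Nonsingular v.1 ∧ v.2 ≠ 0} ∈ 𝓝 (x₀, q₀) :=
    ((continuous_fst.tendsto (x₀, q₀)).eventually (nonsingular_eventually E hx₀)).and
      ((continuous_snd.tendsto (x₀, q₀)).eventually (isOpen_ne.mem_nhds hq₀))
  obtain ⟨B, x₁, h, hB, hh, hmem, hsol⟩ := puiseux Q.natDegree G x₀ q₀ hG
    ((hGs q₀).trans hroot) ⟨_, le_rfl, by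
      simp only [pd, hGs]
      exact exists_deriv_ne Q hQ0 q₀⟩ _ hW
  exact ⟨x₁, B * l, B * s, Nat.mul_pos hB hl, Nat.mul_pos hB hs, hmem.1,
    pole_of_branch E x₁ hmem.1 B l s D hB hl hs hDle h hh hmem.2 hsol⟩

end Petrovic

namespace Petrovic
open Filter

theorem edge_of_pole (E : FirstOrderAlgODE) {x₀ : ℂ} {l s : ℕ} (hl : 1 ≤ l) (hs : 1 ≤ s)
    (hx : E.Nonsingular x₀) (hsol : E.SolutionWithPole x₀ l s) :
    E.HasEdge (-(l : ℝ) / s) := by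
  obtain ⟨r, hr, u, c₀, hc₀, hud, hO, hEq⟩ := hsol
  have hlc : (l : ℂ) ≠ 0 := by exact_mod_cast (by omega : l ≠ 0)
  have hsc : (s : ℂ) ≠ 0 := by exact_mod_cast (by omega : s ≠ 0)
  have hopen : IsOpen {t : ℂ | 0 < ‖t‖ ∧ ‖t‖ < r} :=
    (isOpen_lt continuous_const continuous_norm).inter (isOpen_lt continuous_norm continuous_const)
  have hpunct : ∀ᶠ t in 𝓝[≠] (0 : ℂ), 0 < ‖t‖ ∧ ‖t‖ < r := by
    have h1 : ∀ᶠ t in 𝓝[≠] (0 : ℂ), t ≠ 0 := self_mem_nhdsWithin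
    have h2 : ∀ᶠ t in 𝓝[≠] (0 : ℂ), t ∈ Metric.ball (0 : ℂ) r :=
      nhdsWithin_le_nhds (Metric.ball_mem_nhds _ hr)
    filter_upwards [h1, h2] with t a b
    exact ⟨norm_pos_iff.2 a, by simpa using b⟩
  let v : ℂ → ℂ := Function.update (fun t => t ^ l * u t) 0 c₀
  have hv0 : v 0 = c₀ := by simp [v]
  have hvne : ∀ t, t ≠ 0 → v t = t ^ l * u t := fun t ht => by simp [v, ht]
  have hvc : ContinuousAt v 0 := by
    rw [continuousAt_update_same]
    have h1 := (Asymptotics.isBigO_refl (fun t : ℂ => t ^ l) (𝓝[≠] (0 : ℂ))).mul hO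
    have h2 : (fun t => t ^ l * u t - c₀) =O[𝓝[≠] (0 : ℂ)] fun t => t := by
      refine h1.congr' ?_ ?_
      · filter_upwards [self_mem_nhdsWithin] with t ht
        have : t ^ l ≠ 0 := pow_ne_zero _ ht
        rw [zpow_neg, zpow_natCast]
        field_simp
      · filter_upwards [self_mem_nhdsWithin] with t ht
        have : t ^ l ≠ 0 := pow_ne_zero _ ht
        rw [zpow_add_one₀ ht, zpow_neg, zpow_natCast]
        field_simp
    have h3 : Tendsto (fun t => t ^ l * u t - c₀) (𝓝[≠] (0 : ℂ)) (𝓝 0) :=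
      h2.trans_tendsto (tendsto_id.mono_left nhdsWithin_le_nhds)
    simpa using h3.add_const c₀
  have hvd : ∀ᶠ t in 𝓝[≠] (0 : ℂ), DifferentiableAt ℂ v t := by
    filter_upwards [hpunct] with t ht
    have htne : t ≠ 0 := norm_pos_iff.1 ht.1
    have h1 : DifferentiableAt ℂ (fun t => t ^ l * u t) t :=
      (differentiableAt_pow l).mul ((hud t ht).differentiableAt (hopen.mem_nhds ht))
    refine h1.congr_of_eventuallyEq ?_
    filter_upwards [isOpen_ne.mem_nhds htne] with t' ht'
    exact hvne t' ht'
  have hva : AnalyticAt ℂ v 0 :=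
    Complex.analyticAt_of_differentiable_on_punctured_nhds_of_continuousAt hvd hvc
  let p : ℂ → ℂ := fun t => (t * deriv v t - l * v t) / s
  have hpc : ContinuousAt p 0 :=
    ((continuousAt_id.mul hva.deriv.continuousAt).sub (continuousAt_const.mul hvc)).div_const _
  have hp0 : p 0 ≠ 0 := by
    simp [p, hv0, hc₀, hlc, hsc]
  have hup : ∀ᶠ t in 𝓝[≠] (0 : ℂ), t ^ (l + s) * (deriv u t / ((s : ℂ) * t ^ (s - 1))) = p t := by
    filter_upwards [hpunct] with t ht
    have htne : t ≠ 0 := norm_pos_iff.1 ht.1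
    have hdu := ((hud t ht).differentiableAt (hopen.mem_nhds ht)).hasDerivAt
    have h1 : HasDerivAt (fun t => t ^ l * u t) (l * t ^ (l - 1) * u t + t ^ l * deriv u t) t :=
      (hasDerivAt_pow l t).mul hdu
    have h2 : HasDerivAt v (l * t ^ (l - 1) * u t + t ^ l * deriv u t) t := by
      refine h1.congr_of_eventuallyEq ?_
      filter_upwards [isOpen_ne.mem_nhds htne] with t' ht'
      exact hvne t' ht'
    simp only [p]
    rw [h2.deriv, hvne t htne]
    have p1 : t ^ l = t ^ (l - 1) * t := by rw [← pow_succ]; congr 1; omega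
    have p2 : t ^ s = t ^ (s - 1) * t := by rw [← pow_succ]; congr 1; omega
    have p3 : t ^ (s - 1) ≠ 0 := pow_ne_zero _ htne
    rw [pow_add, p1, p2]
    generalize t ^ (l - 1) = a at *
    generalize t ^ (s - 1) = b at *
    field_simp
    ring
  let e : Fin E.j → ℕ := fun i => l * E.M i + s * E.N i
  have : Nonempty (Fin E.j) := ⟨⟨0, E.hj⟩⟩
  obtain ⟨i₀, -, hmax⟩ := Finset.exists_max_image Finset.univ e Finset.univ_nonempty
  have hmax' : ∀ i, e i ≤ e i₀ := fun i => hmax i (Finset.mem_univ _)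
  let S : ℂ → ℂ := fun t => ∑ i, E.φ i (x₀ + t ^ s) * v t ^ E.m₀ i * p t ^ E.m₁ i * t ^ (e i₀ - e i)
  have hSc : ContinuousAt S 0 := by
    refine tendsto_finsetSum _ fun i _ => ?_
    have h1 : ContinuousAt (fun t : ℂ => E.φ i (x₀ + t ^ s)) 0 := by
      refine ContinuousAt.comp (g := E.φ i) (f := fun t : ℂ => x₀ + t ^ s) ?_ (by fun_prop)
      simp only [zero_pow (by omega : s ≠ 0), add_zero]
      exact (hx.2 i).1.continuousAt
    exact ((h1.mul (hvc.pow _)).mul (hpc.pow _)).mul (continuousAt_id.pow _)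
  have hS0 : ∀ᶠ t in 𝓝[≠] (0 : ℂ), S t = 0 := by
    filter_upwards [hpunct, hup] with t ht hp
    have htne : t ≠ 0 := norm_pos_iff.1 ht.1
    have h0 := hEq t ht.1 ht.2
    have : S t = t ^ e i₀ * ∑ i : Fin E.j, E.φ i (x₀ + t ^ s) * u t ^ E.m₀ i *
        (deriv u t / ((s : ℂ) * t ^ (s - 1))) ^ E.m₁ i := by
      rw [Finset.mul_sum]
      refine Finset.sum_congr rfl fun i _ => ?_
      rw [← hp, hvne t htne]
      generalize deriv u t / ((s : ℂ) * t ^ (s - 1)) = y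
      have hsplit : t ^ e i₀ = (t ^ l) ^ E.m₀ i * (t ^ (l + s)) ^ E.m₁ i * t ^ (e i₀ - e i) := by
        rw [← pow_mul, ← pow_mul, ← pow_add, ← pow_add]
        congr 1
        have : l * E.m₀ i + (l + s) * E.m₁ i = e i := by
          simp only [e, FirstOrderAlgODE.M, FirstOrderAlgODE.N]; ring
        have := hmax' i
        omega
      rw [hsplit]
      ring
    rw [this, h0, mul_zero]
  have hSz : S 0 = 0 := by
    have h1 : Tendsto S (𝓝[≠] (0 : ℂ)) (𝓝 (S 0)) := hSc.tendsto.mono_left nhdsWithin_le_nhds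
    have h2 : Tendsto S (𝓝[≠] (0 : ℂ)) (𝓝 0) :=
      tendsto_const_nhds.congr' (hS0.mono fun t ht => ht.symm)
    exact tendsto_nhds_unique h1 h2
  have hex : ∃ i₁, i₁ ≠ i₀ ∧ e i₁ = e i₀ := by
    by_contra! hcon
    simp only [S, zero_pow (by omega : s ≠ 0), add_zero] at hSz
    rw [Finset.sum_eq_single i₀] at hSz
    · simp only [Nat.sub_self, pow_zero, mul_one, hv0] at hSz
      exact mul_ne_zero (mul_ne_zero (hx.2 i₀).2 (pow_ne_zero _ hc₀)) (pow_ne_zero _ hp0) hSz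
    · intro b _ hb
      have h1 := hcon b hb
      have h2 := hmax' b
      rw [zero_pow (by omega), mul_zero]
    · simp
  obtain ⟨i₁, hi₁, he⟩ := hex
  have hsR : (s : ℝ) ≠ 0 := by exact_mod_cast (by omega : s ≠ 0)
  have hsP : (0 : ℝ) < s := by exact_mod_cast hs
  have hconv : ∀ i, -(l : ℝ) / s * (E.M i : ℝ) - (E.N i : ℝ) = -(e i : ℝ) / s := by
    intro i
    simp only [e]
    push_cast
    field_simp
    ring
  refine ⟨i₀, i₁, ?_, ?_, ?_⟩
  · intro h
    simp only [FirstOrderAlgODE.M, FirstOrderAlgODE.N, Prod.mk.injEq] at h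
    exact hi₁ (E.hdistinct i₁ i₀ (by omega) (by omega))
  · rw [hconv, hconv, he]
  · intro i
    rw [hconv, hconv]
    have : (e i : ℝ) ≤ e i₀ := by exact_mod_cast hmax' i
    gcongr

end Petrovic

/-- **Petrović's theorem on movable poles (1894).**  The poles of the general solution
of a first-order algebraic ODE do not depend on the constants of integration (there is
no nonsingular point of the equation at which some solution has a movable
(possibly critical) pole of some positive rational order `l / s`) if and only if the
Petrović polygon of the equation contains no right slanted edge (no edge whose angular
coefficient is negative). -/
theorem petrovic_no_movable_poles_iff (E : FirstOrderAlgODE) :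
    (¬ ∃ (x₀ : ℂ) (l s : ℕ), 1 ≤ l ∧ 1 ≤ s ∧
        E.Nonsingular x₀ ∧ E.SolutionWithPole x₀ l s) ↔
    (¬ ∃ lam : ℝ, lam < 0 ∧ E.HasEdge lam) := by
  refine not_congr ⟨?_, ?_⟩
  · rintro ⟨x₀, l, s, hl, hs, hx, hsol⟩
    refine ⟨-(l : ℝ) / s, ?_, Petrovic.edge_of_pole E hl hs hx hsol⟩
    have h1 : (0 : ℝ) < l := by exact_mod_cast hl
    have h2 : (0 : ℝ) < s := by exact_mod_cast hs
    exact div_neg_of_neg_of_pos (by linarith) h2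
  · rintro ⟨lam, hlam, hedge⟩
    exact Petrovic.pole_of_edge E hlam hedge
end
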